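/- arXiv:1409.6176 — 2 statements merged into one kernel-verified Lean document; each statement's English description precedes it below -/
import Mathlib

section
/- Let C ⊂ R^{d+1} be a closed pointed full-dimensional cone and F(y) = (1/(d+1)) log ∫_C e^{-⟨x,y⟩} dx on int C*. Then F is strictly convex, and moreover D²_{u,u}F(y) ≥ ∫_{C∩H_y} ⟨x,u⟩² dx / vol_d(C∩H_y) > 0 for all u ≠ 0. -/
open scoped RealInnerProductSpace MeasureTheory
open MeasureTheory

section ConeHelpers

local notation "EE" d => EuclideanSpace ℝ (Fin (d + 1))

lemma cone_orth_inner {d : ℕ} (y : EE d) (w : (ℝ ∙ y)ᗮ) : ⟪(w : EE d), y⟫ = 0 :=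
  Submodule.mem_orthogonal_singleton_iff_inner_left.1 w.2

lemma cone_p_inner {d : ℕ} (y : EE d) (hy : y ≠ 0) :
    ⟪(⟪y, y⟫⁻¹ • y : EE d), y⟫ = 1 := by
  rw [real_inner_smul_left]
  exact inv_mul_cancel₀ (by simpa using hy)

/-- The decomposition of the space along `y`. -/
lemma cone_exists_equiv {d : ℕ} (y : EE d) (hy : y ≠ 0) :
    ∃ L : (ℝ × (ℝ ∙ y)ᗮ) ≃L[ℝ] (EE d), ∀ q, L q = q.1 • (⟪y, y⟫⁻¹ • y) + (q.2 : EE d) := by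
  set p : EE d := ⟪y, y⟫⁻¹ • y with hp
  have hpy : ⟪p, y⟫ = 1 := cone_p_inner y hy
  let M : (ℝ × (ℝ ∙ y)ᗮ) →ₗ[ℝ] (EE d) :=
    (LinearMap.toSpanSingleton ℝ (EE d) p).coprod ((ℝ ∙ y)ᗮ).subtype
  have hM : ∀ q, M q = q.1 • p + (q.2 : EE d) := fun q => by
    simp [M]
  have hb : Function.Bijective M := by
    constructor
    · rw [← LinearMap.ker_eq_bot, LinearMap.ker_eq_bot']
      intro q hq
      rw [hM] at hq
      have h1 : ⟪q.1 • p + (q.2 : EE d), y⟫ = 0 := by rw [hq, inner_zero_left]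
      rw [inner_add_left, real_inner_smul_left, hpy, cone_orth_inner] at h1
      have h2 : q.1 = 0 := by linarith
      rw [h2, zero_smul, zero_add] at hq
      exact Prod.ext h2 (by simpa using hq)
    · intro x
      refine ⟨(⟪x, y⟫, ⟨x - ⟪x, y⟫ • p, ?_⟩), ?_⟩
      · rw [Submodule.mem_orthogonal_singleton_iff_inner_left, inner_sub_left,
          real_inner_smul_left, hpy]
        ring
      · rw [hM]; simp
  exact ⟨(LinearEquiv.ofBijective M hb).toContinuousLinearEquiv, fun q => hM q⟩

lemma cone_section_isometry {d : ℕ} (y : EE d) :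
    Isometry (fun w : (ℝ ∙ y)ᗮ => (⟪y, y⟫⁻¹ • y + (w : EE d))) := by
  apply Isometry.of_dist_eq
  intro a b
  simp [Subtype.dist_eq]

lemma cone_section_range {d : ℕ} (y : EE d) (hy : y ≠ 0) :
    Set.range (fun w : (ℝ ∙ y)ᗮ => (⟪y, y⟫⁻¹ • y + (w : EE d))) = {x | ⟪x, y⟫ = 1} := by
  ext x
  constructor
  · rintro ⟨w, rfl⟩
    simp only [Set.mem_ofPred_eq]
    rw [inner_add_left, cone_p_inner y hy, cone_orth_inner, add_zero]
  · intro hx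
    refine ⟨⟨x - ⟪y, y⟫⁻¹ • y, ?_⟩, by simp⟩
    rw [Submodule.mem_orthogonal_singleton_iff_inner_left, inner_sub_left, cone_p_inner y hy]
    simpa using sub_eq_zero.2 hx

lemma cone_finrank {d : ℕ} (y : EE d) (hy : y ≠ 0) : Module.finrank ℝ (ℝ ∙ y)ᗮ = d := by
  have : Fact (Module.finrank ℝ (EE d) = d + 1) := ⟨by simp⟩
  exact Submodule.finrank_orthogonal_span_singleton hy

lemma cone_isHaar {d : ℕ} (y : EE d) (hy : y ≠ 0) :
    (μH[(d : ℝ)] : Measure (ℝ ∙ y)ᗮ).IsAddHaarMeasure := by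
  have := MeasureTheory.isAddHaarMeasure_hausdorffMeasure (E := (ℝ ∙ y)ᗮ)
  rwa [cone_finrank y hy] at this

lemma cone_section_finite {d : ℕ} (y : EE d) (hy : y ≠ 0) (S : Set (EE d)) (hS : IsCompact S)
    (hSy : ∀ x ∈ S, ⟪x, y⟫ = 1) : μH[(d : ℝ)] S < ⊤ := by
  have := cone_isHaar y hy
  have hj := cone_section_isometry y
  have h1 := hj.hausdorffMeasure_preimage (d := (d : ℝ)) (Or.inl (Nat.cast_nonneg d)) S
  rw [cone_section_range y hy, Set.inter_eq_left.2 (show S ⊆ {x | ⟪x, y⟫ = 1} from fun x hx => hSy x hx)] at h1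
  rw [← h1]
  exact (hj.isClosedEmbedding.isCompact_preimage hS).measure_lt_top

lemma cone_section_integral {d : ℕ} (C : Set (EE d)) (hC : IsClosed C) (y : EE d) (hy : y ≠ 0)
    (f : (EE d) → ℝ) :
    ∫ x in {x ∈ C | ⟪x, y⟫ = 1}, f x ∂μH[(d : ℝ)] =
      ∫ w : (ℝ ∙ y)ᗮ, C.indicator f (⟪y, y⟫⁻¹ • y + (w : EE d)) ∂μH[(d : ℝ)] := by
  have hj := cone_section_isometry y
  have h1 := hj.map_hausdorffMeasure (d := (d : ℝ)) (Or.inl (Nat.cast_nonneg d))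
  rw [cone_section_range y hy] at h1
  have h2 : {x ∈ C | ⟪x, y⟫ = 1} = C ∩ {x | ⟪x, y⟫ = 1} := rfl
  rw [h2, ← Measure.restrict_restrict hC.measurableSet, ← h1, ← integral_indicator hC.measurableSet,
    hj.isClosedEmbedding.measurableEmbedding.integral_map]

lemma cone_slice {d : ℕ} (C : Set (EE d))
    (hC : ∀ x ∈ C, ∀ c : ℝ, 0 ≤ c → c • x ∈ C) (hclosed : IsClosed C)
    (y : EE d) (hy : y ≠ 0) (hpos : ∀ x ∈ C, 0 ≤ ⟪x, y⟫) :
    ∃ c : ℝ, 0 ≤ c ∧ ∀ (f : (EE d) → ℝ) (k : ℕ),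
      (∀ t : ℝ, 0 < t → ∀ x, f (t • x) = t ^ k * f x) →
      IntegrableOn (fun x => f x * Real.exp (-⟪x, y⟫)) C →
      ∫ x in C, f x * Real.exp (-⟪x, y⟫) =
        c * Real.Gamma (d + k + 1) * ∫ x in {x ∈ C | ⟪x, y⟫ = 1}, f x ∂μH[(d : ℝ)] := by
  have := cone_isHaar y hy
  obtain ⟨L, hL⟩ := cone_exists_equiv y hy
  set ν : Measure (ℝ ∙ y)ᗮ := μH[(d : ℝ)] with hν
  have : (Measure.map L ((volume : Measure ℝ).prod ν)).IsAddHaarMeasure :=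
    L.isAddHaarMeasure_map _
  have hvol := Measure.isAddLeftInvariant_eq_smul (volume : Measure (EE d))
    (Measure.map L ((volume : Measure ℝ).prod ν))
  set c0 := Measure.addHaarScalarFactor (volume : Measure (EE d))
    (Measure.map L ((volume : Measure ℝ).prod ν)) with hc0
  have hc0ne : c0 ≠ 0 := by
    intro h
    rw [h, zero_smul] at hvol
    exact NeZero.ne (volume : Measure (EE d)) hvol
  refine ⟨c0, c0.2, fun f k hf hint => ?_⟩
  rw [cone_section_integral C hclosed y hy, ← integral_indicator hclosed.measurableSet]
  rw [← integrable_indicator_iff hclosed.measurableSet] at hint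
  set G : (EE d) → ℝ := C.indicator fun x => f x * Real.exp (-⟪x, y⟫) with hG
  set p : EE d := ⟪y, y⟫⁻¹ • y with hp
  have hpy : ⟪p, y⟫ = 1 := cone_p_inner y hy
  have hLe : MeasurableEmbedding L := L.toHomeomorph.measurableEmbedding
  have hI : Integrable (fun q => G (L q)) ((volume : Measure ℝ).prod ν) := by
    rw [hvol] at hint
    have h3 := (integrable_smul_measure (c := (c0 : ENNReal)) (by simpa using hc0ne) (by simp)).1 hint
    exact (hLe.integrable_map_iff).1 h3
  have h4 : ∫ x, G x = c0 * ∫ t : ℝ, ∫ w, G (t • p + (w : EE d)) ∂ν := by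
    conv_lhs => rw [hvol]
    rw [integral_smul_nnreal_measure, hLe.integral_map, integral_prod _ hI]
    simp only [hL]
    rfl
  set J : ℝ := ∫ w, C.indicator f (p + (w : EE d)) ∂ν with hJ
  have hpt : ∀ t : ℝ, 0 < t → ∀ w : (ℝ ∙ y)ᗮ, G (t • p + ((t • w : (ℝ ∙ y)ᗮ) : EE d)) =
      t ^ k * Real.exp (-t) * C.indicator f (p + (w : EE d)) := by
    intro t ht w
    have e : t • p + ((t • w : (ℝ ∙ y)ᗮ) : EE d) = t • (p + (w : EE d)) := by
      simp [smul_add]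
    have e2 : ⟪t • (p + (w : EE d)), y⟫ = t := by
      rw [real_inner_smul_left, inner_add_left, hpy, cone_orth_inner]; ring
    rw [e, hG]
    by_cases hm : p + (w : EE d) ∈ C
    · rw [Set.indicator_of_mem (hC _ hm t ht.le), Set.indicator_of_mem hm, hf t ht, e2]
      ring
    · have : t • (p + (w : EE d)) ∉ C := by
        intro h
        apply hm
        have := hC _ h t⁻¹ (by positivity)
        rwa [smul_smul, inv_mul_cancel₀ ht.ne', one_smul] at this
      rw [Set.indicator_of_notMem this, Set.indicator_of_notMem hm, mul_zero]
  have h5 : ∀ t : ℝ, 0 < t → ∫ w, G (t • p + (w : EE d)) ∂ν =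
      Real.exp (-t) * t ^ ((d + k + 1 : ℝ) - 1) * J := by
    intro t ht
    have := Measure.integral_comp_smul ν (fun w : (ℝ ∙ y)ᗮ => G (t • p + (w : EE d))) t
    simp only [hpt t ht] at this
    rw [integral_const_mul, cone_finrank y hy, abs_of_pos (by positivity), smul_eq_mul,
      ← hJ] at this
    have h6 : ((d : ℝ) + k + 1) - 1 = ((d + k : ℕ) : ℝ) := by push_cast; ring
    rw [h6, Real.rpow_natCast, pow_add]
    field_simp at this
    linarith
  have h7 : ∫ t : ℝ, ∫ w, G (t • p + (w : EE d)) ∂ν =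
      ∫ t in Set.Ioi (0 : ℝ), ∫ w, G (t • p + (w : EE d)) ∂ν := by
    rw [← integral_Ici_eq_integral_Ioi]
    symm
    apply setIntegral_eq_integral_of_forall_compl_eq_zero
    intro t ht
    rw [Set.mem_Ici, not_le] at ht
    apply integral_eq_zero_of_ae
    refine Filter.Eventually.of_forall fun w => ?_
    apply Set.indicator_of_notMem
    intro hm
    have := hpos _ hm
    rw [inner_add_left, real_inner_smul_left, hpy, cone_orth_inner] at this
    linarith
  rw [h4, h7, setIntegral_congr_fun measurableSet_Ioi (fun t ht => h5 t ht), integral_mul_const,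
    ← Real.Gamma_eq_integral (by positivity), mul_assoc]

lemma cone_eps {d : ℕ} (C : Set (EE d)) (y : EE d)
    (hy : y ∈ interior {z : EE d | ∀ x ∈ C, 0 ≤ ⟪x, z⟫}) :
    ∃ ε : ℝ, 0 < ε ∧ ∀ x ∈ C, ε * ‖x‖ ≤ ⟪x, y⟫ := by
  rw [mem_interior_iff_mem_nhds, Metric.mem_nhds_iff] at hy
  obtain ⟨r, hr, hb⟩ := hy
  refine ⟨r / 2, by positivity, fun x hx => ?_⟩
  rcases eq_or_ne x 0 with rfl | hx0
  · simp
  have hn : 0 < ‖x‖ := norm_pos_iff.2 hx0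
  have hm : y - (r / 2 * ‖x‖⁻¹) • x ∈ Metric.ball y r := by
    rw [Metric.mem_ball, dist_eq_norm, sub_sub_cancel_left, norm_neg, norm_smul,
      Real.norm_of_nonneg (by positivity), mul_assoc, inv_mul_cancel₀ hn.ne']
    linarith
  have h := hb hm x hx
  rw [inner_sub_right, real_inner_smul_right, real_inner_self_eq_norm_sq] at h
  have : r / 2 * ‖x‖⁻¹ * ‖x‖ ^ 2 = r / 2 * ‖x‖ := by field_simp
  linarith

lemma cone_integrable {d : ℕ} (k : ℕ) (ε : ℝ) (hε : 0 < ε) :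
    Integrable (fun x : EE d => ‖x‖ ^ k * Real.exp (-(ε * ‖x‖))) := by
  rw [integrable_fun_norm_addHaar (volume : Measure (EE d))
    (f := fun r => r ^ k * Real.exp (-(ε * r)))]
  have h := integrableOn_rpow_mul_exp_neg_mul_rpow (p := 1) (s := ((d + k : ℕ) : ℝ)) (b := ε)
    (by have : (0 : ℝ) ≤ ((d + k : ℕ) : ℝ) := Nat.cast_nonneg _
        linarith) one_pos hε
  refine h.congr_fun (fun t _ => ?_) measurableSet_Ioi
  simp only [Real.rpow_natCast, Real.rpow_one, finrank_euclideanSpace, Fintype.card_fin,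
    Nat.add_sub_cancel, smul_eq_mul, pow_add]
  ring_nf

lemma cone_integrableOn {d : ℕ} (C : Set (EE d)) (hclosed : IsClosed C) (y : EE d) (ε : ℝ)
    (hε : 0 < ε) (hy : ∀ x ∈ C, ε * ‖x‖ ≤ ⟪x, y⟫) (g : (EE d) → ℝ) (hg : Continuous g) (A : ℝ)
    (k : ℕ) (hA : ∀ x, |g x| ≤ A * ‖x‖ ^ k) :
    IntegrableOn (fun x => g x * Real.exp (-⟪x, y⟫)) C := by
  refine (((cone_integrable (d := d) k ε hε).const_mul A).integrableOn (s := C)).mono'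
    (Continuous.aestronglyMeasurable (by fun_prop)) ?_
  refine (ae_restrict_iff' hclosed.measurableSet).2 (Filter.Eventually.of_forall fun x hx => ?_)
  rw [Real.norm_eq_abs, abs_mul, Real.abs_exp, ← mul_assoc]
  exact mul_le_mul (hA x) (Real.exp_le_exp.2 (neg_le_neg (hy x hx))) (Real.exp_pos _).le
    ((abs_nonneg _).trans (hA x))

lemma cone_hasFDerivAt {d : ℕ} (C : Set (EE d)) (hclosed : IsClosed C) (y : EE d)
    (hyC : y ∈ interior {z : EE d | ∀ x ∈ C, 0 ≤ ⟪x, z⟫})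
    (g : (EE d) → ℝ) (hg : Continuous g) (A : ℝ)
    (k : ℕ) (hA : ∀ x, |g x| ≤ A * ‖x‖ ^ k) :
    ∃ L : (EE d) →L[ℝ] ℝ, HasFDerivAt (fun z => ∫ x in C, g x * Real.exp (-⟪x, z⟫)) L y ∧
      ∀ u, L u = - ∫ x in C, (g x * ⟪x, u⟫) * Real.exp (-⟪x, y⟫) := by
  obtain ⟨ε, hε, hy⟩ := cone_eps C y hyC
  set F' : (EE d) → (EE d) → ((EE d) →L[ℝ] ℝ) :=
    fun z x => (g x * Real.exp (-⟪x, z⟫)) • (-(innerSL ℝ x)) with hF'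
  have hcont : ∀ z, Continuous (F' z) := fun z => by
    simp only [hF']
    fun_prop
  have hbi : IntegrableOn (fun x : EE d => A * (‖x‖ ^ (k + 1) * Real.exp (-(ε / 2 * ‖x‖)))) C :=
    ((cone_integrable (d := d) (k + 1) (ε / 2) (by positivity)).const_mul A).integrableOn
  have hbd : ∀ᵐ x ∂(volume.restrict C), ∀ z ∈ Metric.ball y (ε / 2), ‖F' z x‖ ≤
      A * (‖x‖ ^ (k + 1) * Real.exp (-(ε / 2 * ‖x‖))) := by
    refine (ae_restrict_iff' hclosed.measurableSet).2 (Filter.Eventually.of_forall ?_)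
    intro x hx z hz
    have h1 : ε / 2 * ‖x‖ ≤ ⟪x, z⟫ := by
      have h2 := hy x hx
      have h3 : ⟪x, y⟫ - ⟪x, z⟫ ≤ ‖x‖ * (ε / 2) := by
        rw [← inner_sub_right]
        refine (real_inner_le_norm _ _).trans ?_
        rw [Metric.mem_ball, dist_comm, dist_eq_norm] at hz
        exact mul_le_mul_of_nonneg_left hz.le (norm_nonneg _)
      linarith
    rw [hF', norm_smul, norm_neg, innerSL_apply_norm, Real.norm_eq_abs, abs_mul, Real.abs_exp]
    calc |g x| * Real.exp (-⟪x, z⟫) * ‖x‖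
        ≤ (A * ‖x‖ ^ k) * Real.exp (-(ε / 2 * ‖x‖)) * ‖x‖ := by
          refine mul_le_mul_of_nonneg_right ?_ (norm_nonneg _)
          exact mul_le_mul (hA x) (Real.exp_le_exp.2 (neg_le_neg h1)) (Real.exp_pos _).le
            ((abs_nonneg _).trans (hA x))
      _ = _ := by ring
  have hball : Metric.ball y (ε / 2) ∈ nhds y := Metric.ball_mem_nhds _ (by positivity)
  have hint : Integrable (F' y) (volume.restrict C) :=
    hbi.mono' (hcont y).aestronglyMeasurable (hbd.mono fun x hx =>
      hx y (mem_of_mem_nhds hball))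
  refine ⟨∫ x in C, F' y x, ?_, fun u => ?_⟩
  · refine hasFDerivAt_integral_of_dominated_of_fderiv_le hball
      (Filter.Eventually.of_forall fun z => Continuous.aestronglyMeasurable (by fun_prop))
      (cone_integrableOn C hclosed y ε hε hy g hg A k hA) (hcont y).aestronglyMeasurable hbd hbi
      (Filter.Eventually.of_forall fun x z _ => ?_)
    have h1 : HasFDerivAt (fun z => -⟪x, z⟫) (-(innerSL ℝ x)) z :=
      ((innerSL ℝ x).hasFDerivAt).neg
    have h2 := (h1.exp).const_mul (g x)
    simp only [hF']
    rw [mul_smul]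
    exact h2
  · rw [ContinuousLinearMap.integral_apply hint, ← integral_neg]
    congr 1
    ext x
    simp only [hF', smul_apply, neg_apply,
      innerSL_apply_apply, smul_eq_mul]
    ring

lemma cone_exists_inner_ne {d : ℕ} (C : Set (EE d)) (hfull : (interior C).Nonempty)
    (u : EE d) (hu : u ≠ 0) : ∃ x ∈ interior C, ⟪x, u⟫ ≠ 0 := by
  obtain ⟨x0, hx0⟩ := hfull
  by_cases h0 : ⟪x0, u⟫ = 0
  · have hc : Continuous (fun s : ℝ => x0 + s • u) := by fun_prop
    have hn : (fun s : ℝ => x0 + s • u) ⁻¹' interior C ∈ nhds (0 : ℝ) :=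
      (isOpen_interior.preimage hc).mem_nhds (by simpa using hx0)
    obtain ⟨r, hr, hb⟩ := Metric.mem_nhds_iff.1 hn
    have hm : r / 2 ∈ Metric.ball (0 : ℝ) r := by
      rw [Metric.mem_ball, Real.dist_eq, sub_zero, abs_of_pos (by positivity)]
      linarith
    refine ⟨_, hb hm, ?_⟩
    rw [inner_add_left, h0, real_inner_smul_left, zero_add]
    exact mul_ne_zero (by positivity) (by simpa using hu)
  · exact ⟨x0, hx0, h0⟩

lemma cone_integral_pos {d : ℕ} (C : Set (EE d)) (y : EE d)
    (g : (EE d) → ℝ) (hg : Continuous g) (hg0 : ∀ x, 0 ≤ g x)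
    (hne : ∃ x ∈ interior C, g x ≠ 0)
    (hint : IntegrableOn (fun x => g x * Real.exp (-⟪x, y⟫)) C) :
    0 < ∫ x in C, g x * Real.exp (-⟪x, y⟫) := by
  rw [setIntegral_pos_iff_support_of_nonneg_ae (Filter.Eventually.of_forall fun x =>
    mul_nonneg (hg0 x) (Real.exp_pos _).le) hint]
  have hc : Continuous fun x => g x * Real.exp (-⟪x, y⟫) := by fun_prop
  have ho : IsOpen (Function.support (fun x => g x * Real.exp (-⟪x, y⟫)) ∩ interior C) :=
    (hc.isOpen_support).inter isOpen_interior
  obtain ⟨x, hx, hgx⟩ := hne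
  refine (ho.measure_pos volume ⟨x, ?_, hx⟩).trans_le
    (measure_mono (Set.inter_subset_inter_right _ interior_subset))
  exact mul_ne_zero hgx (Real.exp_pos _).ne'

lemma cone_main {d : ℕ} (C : Set (EE d))
    (hC : ∀ x ∈ C, ∀ c : ℝ, 0 ≤ c → c • x ∈ C) (hclosed : IsClosed C)
    (hfull : (interior C).Nonempty) (y : EE d)
    (hyC : y ∈ interior {z : EE d | ∀ x ∈ C, 0 ≤ ⟪x, z⟫}) (u : EE d) (hu : u ≠ 0) :
    (0 < (∫ x in {x ∈ C | ⟪x, y⟫ = 1}, ⟪x, u⟫ ^ 2 ∂μH[(d : ℝ)])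
              / (μH[(d : ℝ)] {x ∈ C | ⟪x, y⟫ = 1}).toReal ∧
        (∫ x in {x ∈ C | ⟪x, y⟫ = 1}, ⟪x, u⟫ ^ 2 ∂μH[(d : ℝ)])
              / (μH[(d : ℝ)] {x ∈ C | ⟪x, y⟫ = 1}).toReal ≤
          fderiv ℝ (fun z => fderiv ℝ
            (fun w => (d + 1 : ℝ)⁻¹ * Real.log (∫ x in C, Real.exp (-⟪x, w⟫)))
            z u) y u) ∧
    DifferentiableAt ℝ
      (fun w => (d + 1 : ℝ)⁻¹ * Real.log (∫ x in C, Real.exp (-⟪x, w⟫))) y := by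
  have hone : ∀ z : EE d, ∫ x in C, Real.exp (-⟪x, z⟫) =
      ∫ x in C, (fun _ => (1 : ℝ)) x * Real.exp (-⟪x, z⟫) := fun z => by simp only [one_mul]
  -- growth bounds
  have b0 : ∀ x : EE d, |(fun _ => (1 : ℝ)) x| ≤ 1 * ‖x‖ ^ 0 := fun x => by simp
  have b1 : ∀ x : EE d, |⟪x, u⟫| ≤ ‖u‖ * ‖x‖ ^ 1 := fun x => by
    rw [pow_one, mul_comm]; exact abs_real_inner_le_norm x u
  have b2 : ∀ x : EE d, |⟪x, u⟫ ^ 2| ≤ ‖u‖ ^ 2 * ‖x‖ ^ 2 := fun x => by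
    rw [abs_pow, ← mul_pow]
    refine pow_le_pow_left₀ (abs_nonneg _) ?_ 2
    simpa using b1 x
  have c1 : Continuous (fun x : EE d => ⟪x, u⟫) := by fun_prop
  have c2 : Continuous (fun x : EE d => ⟪x, u⟫ ^ 2) := by fun_prop
  -- first derivative
  have hφpos : ∀ z ∈ interior {z : EE d | ∀ x ∈ C, 0 ≤ ⟪x, z⟫},
      0 < ∫ x in C, (fun _ => (1 : ℝ)) x * Real.exp (-⟪x, z⟫) := by
    intro z hz
    obtain ⟨ε, hε, hε'⟩ := cone_eps C z hz
    obtain ⟨x, hx⟩ := hfull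
    exact cone_integral_pos C z _ continuous_const (fun _ => zero_le_one) ⟨x, hx, one_ne_zero⟩
      (cone_integrableOn C hclosed z ε hε hε' _ continuous_const 1 0 b0)
  have hd1 : ∀ z ∈ interior {z : EE d | ∀ x ∈ C, 0 ≤ ⟪x, z⟫}, ∃ L : (EE d) →L[ℝ] ℝ,
      HasFDerivAt (fun w => (d + 1 : ℝ)⁻¹ * Real.log (∫ x in C, Real.exp (-⟪x, w⟫))) L z ∧
      L u = (d + 1 : ℝ)⁻¹ * ((∫ x in C, (fun _ => (1 : ℝ)) x * Real.exp (-⟪x, z⟫))⁻¹ *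
        -(∫ x in C, ⟪x, u⟫ * Real.exp (-⟪x, z⟫))) := by
    intro z hz
    obtain ⟨L, hL, hLu⟩ := cone_hasFDerivAt C hclosed z hz _ continuous_const 1 0 b0
    refine ⟨_, by
      simp only [hone]
      exact (hL.log (hφpos z hz).ne').const_mul _, ?_⟩
    simp only [smul_apply, smul_eq_mul, hLu, one_mul]
  refine ⟨?_, by
    obtain ⟨L, hL, -⟩ := hd1 y hyC
    exact hL.differentiableAt⟩
  -- second derivative
  have heq : (fun z => fderiv ℝ
            (fun w => (d + 1 : ℝ)⁻¹ * Real.log (∫ x in C, Real.exp (-⟪x, w⟫))) z u)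
      =ᶠ[nhds y] fun z => (d + 1 : ℝ)⁻¹ *
        ((∫ x in C, (fun _ => (1 : ℝ)) x * Real.exp (-⟪x, z⟫))⁻¹ *
        -(∫ x in C, ⟪x, u⟫ * Real.exp (-⟪x, z⟫))) := by
    filter_upwards [isOpen_interior.mem_nhds hyC] with z hz
    obtain ⟨L, hL, hLu⟩ := hd1 z hz
    rw [hL.fderiv, hLu]
  obtain ⟨L0, hL0, hL0u⟩ := cone_hasFDerivAt C hclosed y hyC _ continuous_const 1 0 b0
  obtain ⟨L1, hL1, hL1u⟩ := cone_hasFDerivAt C hclosed y hyC _ c1 _ 1 b1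
  have hφ := hφpos y hyC
  have hder := (((hasDerivAt_inv hφ.ne').comp_hasFDerivAt y hL0).mul hL1.neg).const_mul
    (d + 1 : ℝ)⁻¹
  have hfd : fderiv ℝ (fun z => fderiv ℝ
            (fun w => (d + 1 : ℝ)⁻¹ * Real.log (∫ x in C, Real.exp (-⟪x, w⟫))) z u) y u =
      (d + 1 : ℝ)⁻¹ *
        ((∫ x in C, ⟪x, u⟫ ^ 2 * Real.exp (-⟪x, y⟫)) /
            (∫ x in C, (fun _ => (1 : ℝ)) x * Real.exp (-⟪x, y⟫)) -
          ((∫ x in C, ⟪x, u⟫ * Real.exp (-⟪x, y⟫)) /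
            (∫ x in C, (fun _ => (1 : ℝ)) x * Real.exp (-⟪x, y⟫))) ^ 2) := by
    rw [heq.fderiv_eq]
    refine (congrArg (fun L : (EE d) →L[ℝ] ℝ => L u) hder.fderiv).trans ?_
    simp only [smul_apply, add_apply, neg_apply, smul_eq_mul, hL0u, hL1u,
      Function.comp_apply, Pi.neg_apply, ← sq]
    simp only [one_mul] at hφ ⊢
    field_simp
    ring
  -- slicing
  obtain ⟨ε, hε, hεy⟩ := cone_eps C y hyC
  obtain ⟨x1, hx1, hx1u⟩ := cone_exists_inner_ne C hfull u hu
  have hy0 : y ≠ 0 := by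
    rintro rfl
    have h := hεy x1 (interior_subset hx1)
    rw [inner_zero_right] at h
    have : 0 < ‖x1‖ := norm_pos_iff.2 (by rintro rfl; simp at hx1u)
    have := mul_pos hε this
    linarith
  obtain ⟨c, hc0, hc⟩ := cone_slice C hC hclosed y hy0
    (fun x hx => (mul_nonneg hε.le (norm_nonneg _)).trans (hεy x hx))
  have i0 := cone_integrableOn C hclosed y ε hε hεy _ continuous_const 1 0 b0
  have i1 := cone_integrableOn C hclosed y ε hε hεy _ c1 _ 1 b1
  have i2 := cone_integrableOn C hclosed y ε hε hεy _ c2 _ 2 b2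
  have s0 := hc _ 0 (fun t _ x => by simp) i0
  have s1 := hc _ 1 (fun t _ x => by rw [real_inner_smul_left, pow_one]) i1
  have s2 := hc _ 2 (fun t _ x => by rw [real_inner_smul_left, mul_pow]) i2
  have p2 := cone_integral_pos C y _ c2 (fun x => sq_nonneg _)
    ⟨x1, hx1, pow_ne_zero 2 hx1u⟩ i2
  set S : Set (EE d) := {x ∈ C | ⟪x, y⟫ = 1} with hS
  have hScl : IsClosed S := hclosed.inter (isClosed_eq (by fun_prop) continuous_const)
  have hScpt : IsCompact S := by
    refine Metric.isCompact_of_isClosed_isBounded hScl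
      ((Metric.isBounded_closedBall (x := (0 : EE d)) (r := ε⁻¹)).subset fun x hx => ?_)
    rw [mem_closedBall_zero_iff]
    have h := hεy x hx.1
    rw [hx.2] at h
    rw [← one_div, le_div_iff₀ hε]
    linarith
  have hfin : μH[(d : ℝ)] S < ⊤ := cone_section_finite y hy0 S hScpt fun x hx => hx.2
  have hIS : ∀ g : (EE d) → ℝ, Continuous g → IntegrableOn g S μH[(d : ℝ)] := fun g hg => by
    obtain ⟨B, hB⟩ := hScpt.exists_bound_of_continuousOn hg.continuousOn
    exact Measure.integrableOn_of_bounded hfin.ne hg.aestronglyMeasurable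
      ((ae_restrict_iff' hScl.measurableSet).2 (Filter.Eventually.of_forall hB))
  have hV : ∫ _ in S, (1 : ℝ) ∂μH[(d : ℝ)] = (μH[(d : ℝ)] S).toReal := by
    simp [Measure.real]
  rw [hV] at s0
  set V : ℝ := (μH[(d : ℝ)] S).toReal with hVdef
  set M : ℝ := ∫ x in S, ⟪x, u⟫ ∂μH[(d : ℝ)] with hM
  set Q : ℝ := ∫ x in S, ⟪x, u⟫ ^ 2 ∂μH[(d : ℝ)] with hQ
  have hCS : ∀ a : ℝ, 0 ≤ Q - 2 * a * M + a ^ 2 * V := by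
    intro a
    have h1 : 0 ≤ ∫ x in S, (⟪x, u⟫ - a) ^ 2 ∂μH[(d : ℝ)] :=
      integral_nonneg fun x => sq_nonneg _
    have h2 : ∫ x in S, (⟪x, u⟫ - a) ^ 2 ∂μH[(d : ℝ)] =
        ∫ x in S, ((⟪x, u⟫ ^ 2 - (2 * a) * ⟪x, u⟫) + a ^ 2 * 1) ∂μH[(d : ℝ)] := by
      congr 1; ext x; ring
    rw [h2, integral_add (hIS (fun x => ⟪x, u⟫ ^ 2 - (2 * a) * ⟪x, u⟫) (by fun_prop))
      (hIS _ continuous_const),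
      integral_sub (hIS _ c2) ((hIS _ c1).const_mul _), integral_const_mul, integral_const_mul,
      hV] at h1
    exact h1
  have hV0 : 0 ≤ V := ENNReal.toReal_nonneg
  have hQ0 : 0 ≤ Q := integral_nonneg fun x => sq_nonneg _
  have g0 : Real.Gamma ((d : ℝ) + (0 : ℕ) + 1) = d.factorial := by
    rw [Nat.cast_zero, add_zero, Real.Gamma_nat_eq_factorial]
  have g1 : Real.Gamma ((d : ℝ) + (1 : ℕ) + 1) = (d + 1) * d.factorial := by
    rw [← Nat.cast_add, Real.Gamma_nat_eq_factorial, Nat.factorial_succ]; push_cast; ring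
  have g2 : Real.Gamma ((d : ℝ) + (2 : ℕ) + 1) = (d + 2) * ((d + 1) * d.factorial) := by
    rw [← Nat.cast_add, Real.Gamma_nat_eq_factorial, Nat.factorial_succ, Nat.factorial_succ]
    push_cast; ring
  rw [g0] at s0
  rw [g1] at s1
  rw [g2] at s2
  have hfac : (0 : ℝ) < d.factorial := by exact_mod_cast d.factorial_pos
  rw [s0] at hφ
  rw [s2] at p2
  have hVpos : 0 < V := lt_of_le_of_ne hV0 fun h => by rw [← h, mul_zero] at hφ; exact lt_irrefl _ hφ
  have hQpos : 0 < Q := lt_of_le_of_ne hQ0 fun h => by rw [← h, mul_zero] at p2; exact lt_irrefl _ p2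
  have hcpos : 0 < c := lt_of_le_of_ne hc0 fun h => by
    rw [← h, zero_mul, zero_mul] at hφ; exact lt_irrefl _ hφ
  refine ⟨div_pos hQpos hVpos, ?_⟩
  rw [hfd, s0, s1, s2]
  have hd : (0 : ℝ) ≤ d := Nat.cast_nonneg d
  have key : (d + 1 : ℝ)⁻¹ * (c * ((d + 2) * ((d + 1) * d.factorial)) * Q / (c * d.factorial * V) -
      (c * ((d + 1) * d.factorial) * M / (c * d.factorial * V)) ^ 2) =
      (d + 2) * (Q / V) - (d + 1) * (M / V) ^ 2 := by
    field_simp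
  rw [key]
  have h9 : (M / V) ^ 2 ≤ Q / V := by
    have h := hCS (M / V)
    have h' : Q - 2 * (M / V) * M + (M / V) ^ 2 * V = V * (Q / V - (M / V) ^ 2) := by
      field_simp
      ring
    rw [h'] at h
    have := nonneg_of_mul_nonneg_right h hVpos
    linarith
  nlinarith

end ConeHelpers


/-- for a closed pointed full-dimensional cone `C ⊆ ℝ^{d+1}`, the
function `F(y) = (1/(d+1)) log ∫_C e^{-⟨x,y⟩} dx` is strictly convex on
`int C*`, and its second directional derivative satisfies
`D²_{u,u}F(y) ≥ ∫_{C∩H_y} ⟨x,u⟩² / vol_d(C∩H_y) > 0` for `u ≠ 0`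
(section integrals with respect to `d`-dimensional Hausdorff measure). -/
theorem strictConvex_cone_volume_functional
    (d : ℕ) (C : Set (EuclideanSpace ℝ (Fin (d + 1))))
    (hC : ∀ x ∈ C, ∀ c : ℝ, 0 ≤ c → c • x ∈ C)
    (hclosed : IsClosed C)
    (hfull : (interior C).Nonempty)
    (hpointed : ∃ e : EuclideanSpace ℝ (Fin (d + 1)),
      ∀ x ∈ C, x ≠ 0 → 0 < ⟪e, x⟫) :
    StrictConvexOn ℝ
      (interior {z : EuclideanSpace ℝ (Fin (d + 1)) | ∀ x ∈ C, 0 ≤ ⟪x, z⟫})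
      (fun z => (d + 1 : ℝ)⁻¹ * Real.log (∫ x in C, Real.exp (-⟪x, z⟫))) ∧
    ∀ y ∈ interior {z : EuclideanSpace ℝ (Fin (d + 1)) | ∀ x ∈ C, 0 ≤ ⟪x, z⟫},
      ∀ u : EuclideanSpace ℝ (Fin (d + 1)), u ≠ 0 →
        (0 < (∫ x in {x ∈ C | ⟪x, y⟫ = 1}, ⟪x, u⟫ ^ 2 ∂μH[(d : ℝ)])
              / (μH[(d : ℝ)] {x ∈ C | ⟪x, y⟫ = 1}).toReal ∧
        (∫ x in {x ∈ C | ⟪x, y⟫ = 1}, ⟪x, u⟫ ^ 2 ∂μH[(d : ℝ)])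
              / (μH[(d : ℝ)] {x ∈ C | ⟪x, y⟫ = 1}).toReal ≤
          fderiv ℝ (fun z => fderiv ℝ
            (fun w => (d + 1 : ℝ)⁻¹ * Real.log (∫ x in C, Real.exp (-⟪x, w⟫)))
            z u) y u) := by
  have hmain := fun y hy u hu => cone_main C hC hclosed hfull y hy u hu
  refine ⟨?_, fun y hy u hu => (hmain y hy u hu).1⟩
  set F : EuclideanSpace ℝ (Fin (d + 1)) → ℝ :=
    fun z => (d + 1 : ℝ)⁻¹ * Real.log (∫ x in C, Real.exp (-⟪x, z⟫)) with hF
  set U := interior {z : EuclideanSpace ℝ (Fin (d + 1)) | ∀ x ∈ C, 0 ≤ ⟪x, z⟫} with hU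
  have hconv : Convex ℝ U := by
    apply Convex.interior
    intro a ha b hb s t hs ht _ x hx
    rw [inner_add_right, real_inner_smul_right, real_inner_smul_right]
    exact add_nonneg (mul_nonneg hs (ha x hx)) (mul_nonneg ht (hb x hx))
  refine ⟨hconv, ?_⟩
  intro a ha b hb hab s t hs ht hst
  set v := b - a with hv
  have hv0 : v ≠ 0 := sub_ne_zero.2 hab.symm
  set ℓ : ℝ → EuclideanSpace ℝ (Fin (d + 1)) := fun r => a + r • v with hℓ
  have hℓd : ∀ r, HasDerivAt ℓ v r := fun r => by
    have h := ((hasDerivAt_id r).smul_const v).const_add a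
    rw [one_smul] at h
    exact h
  have hℓc : Continuous ℓ := by fun_prop
  set D : Set ℝ := ℓ ⁻¹' U with hD
  have hDo : IsOpen D := isOpen_interior.preimage hℓc
  have hDc : Convex ℝ D := by
    intro p hp q hq α β hα hβ hαβ
    have h := hconv hp hq hα hβ hαβ
    have e : α • ℓ p + β • ℓ q = ℓ (α • p + β • q) := by
      simp only [hℓ]
      calc α • (a + p • v) + β • (a + q • v) = (α + β) • a + (α • p + β • q) • v := by
            simp only [smul_eq_mul]; module
        _ = _ := by rw [hαβ, one_smul]
    rw [e] at h
    exact h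
  have hd1 : ∀ r ∈ D, HasDerivAt (fun r => F (ℓ r)) (fderiv ℝ F (ℓ r) v) r := fun r hr =>
    (hmain (ℓ r) hr v hv0).2.hasFDerivAt.comp_hasDerivAt r (hℓd r)
  have hpos : ∀ r ∈ D, 0 < fderiv ℝ (fun z => fderiv ℝ F z v) (ℓ r) v := fun r hr =>
    (hmain (ℓ r) hr v hv0).1.1.trans_le (hmain (ℓ r) hr v hv0).1.2
  have hsc : StrictConvexOn ℝ D (fun r => F (ℓ r)) := by
    apply strictConvexOn_of_deriv2_pos' hDc
    · exact fun r hr => (hd1 r hr).continuousAt.continuousWithinAt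
    · intro r hr
      have h2 : DifferentiableAt ℝ (fun z => fderiv ℝ F z v) (ℓ r) := by
        by_contra hn
        have := hpos r hr
        rw [fderiv_zero_of_not_differentiableAt hn] at this
        simp at this
      have h3 : HasDerivAt (fun r => fderiv ℝ F (ℓ r) v) _ r :=
        h2.hasFDerivAt.comp_hasDerivAt r (hℓd r)
      have h4 : deriv (fun r => F (ℓ r)) =ᶠ[nhds r] fun r => fderiv ℝ F (ℓ r) v := by
        filter_upwards [hDo.mem_nhds hr] with q hq
        exact (hd1 q hq).deriv
      have h5 : (deriv^[2] (fun r => F (ℓ r))) r =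
          fderiv ℝ (fun z => fderiv ℝ F z v) (ℓ r) v := by
        simp only [Function.iterate_succ, Function.iterate_zero, Function.comp_apply, id]
        rw [h4.deriv_eq, h3.deriv]
      rw [h5]
      exact hpos r hr
  have e0 : ℓ 0 = a := by simp [hℓ]
  have e1 : ℓ 1 = b := by simp [hℓ, hv]
  have h := hsc.2 (x := 0) (y := 1) (by simpa [hD, e0] using ha) (by simpa [hD, e1] using hb)
    zero_ne_one hs ht hst
  have e2 : ℓ (s • 0 + t • 1) = s • a + t • b := by
    have : s = 1 - t := by linarith
    subst this
    simp only [hℓ, hv, smul_eq_mul]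
    module
  simp only [e0, e1, e2] at h
  exact h
end

section
/- For any convex body K ⊂ R^d and unit vector u ∈ R^d, the normalized moment of inertia satisfies W_u(K)²/(2(d+1)(d+2)) ≤ I_u(K)/vol(K) ≤ W_u(K)²/12, where I_u(K) = ∫_K ⟨x - γ(K), u⟩² dx, γ(K) is the centroid of K, and W_u(K) = max_{x∈K}⟨x,u⟩ - min_{x∈K}⟨x,u⟩ is the width of K in direction u. The lower bound is attained by a symmetric double cone over a (d-1)-dimensional convex body (apexes in direction ±u), and the upper bound by a cylinder over a (d-1)-dimensional convex body with axis u. -/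
open scoped RealInnerProductSpace
open MeasureTheory

noncomputable section

/-- Centroid of a set. -/
def centroid {d : ℕ} (K : Set (EuclideanSpace ℝ (Fin d))) :
    EuclideanSpace ℝ (Fin d) :=
  ((volume K).toReal)⁻¹ • ∫ x in K, x

/-- Moment of inertia of `K` with respect to the direction `u`, about the
centroid. -/
def momentOfInertia {d : ℕ} (u : EuclideanSpace ℝ (Fin d))
    (K : Set (EuclideanSpace ℝ (Fin d))) : ℝ :=
  ∫ x in K, ⟪x - centroid K, u⟫ ^ 2

/-- Width of `K` in the direction of the unit vector `u`. -/
def dirWidth {d : ℕ} (u : EuclideanSpace ℝ (Fin d))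
    (K : Set (EuclideanSpace ℝ (Fin d))) : ℝ :=
  sSup ((fun x => ⟪x, u⟫) '' K) - sInf ((fun x => ⟪x, u⟫) '' K)

/-- Symmetric double cone of half-height `a` over a base `B` lying in the
hyperplane orthogonal to `u`, with apexes at `±a • u`. -/
def doubleCone {d : ℕ} (u : EuclideanSpace ℝ (Fin d)) (a : ℝ)
    (B : Set (EuclideanSpace ℝ (Fin d))) : Set (EuclideanSpace ℝ (Fin d)) :=
  {z | ∃ b ∈ B, ∃ t : ℝ, |t| ≤ a ∧ z = (1 - |t| / a) • b + t • u}

/-- Cylinder of half-height `a` over a base `B` lying in the hyperplane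
orthogonal to `u`, with axis direction `u`. -/
def cylinder {d : ℕ} (u : EuclideanSpace ℝ (Fin d)) (a : ℝ)
    (B : Set (EuclideanSpace ℝ (Fin d))) : Set (EuclideanSpace ℝ (Fin d)) :=
  {z | ∃ b ∈ B, ∃ t : ℝ, |t| ≤ a ∧ z = b + t • u}

open scoped Pointwise

theorem bm_one {A B C : Set ℝ} {a : ℝ} (ha : 0 < a) (ha1 : a < 1)
    (hA : MeasurableSet A) (hB : MeasurableSet B) (hAn : A.Nonempty) (hBn : B.Nonempty)
    (hC : ∀ x ∈ A, ∀ y ∈ B, (1 - a) * x + a * y ∈ C) :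
    ENNReal.ofReal (1 - a) * volume A + ENNReal.ofReal a * volume B ≤ volume C := by
  have key : ∀ A' ⊆ A, IsCompact A' → ∀ B' ⊆ B, IsCompact B' → A'.Nonempty → B'.Nonempty →
      ENNReal.ofReal (1 - a) * volume A' + ENNReal.ofReal a * volume B' ≤ volume C := by
    intro A' hA' cA B' hB' cB nA nB
    obtain ⟨p, hp, hpm⟩ := cA.exists_isGreatest nA
    obtain ⟨q, hq, hqm⟩ := cB.exists_isLeast nB
    set S : Set ℝ := (fun x => a * q + x) '' ((1 - a) • A') with hS
    set T : Set ℝ := (fun x => (1 - a) * p + x) '' (a • B') with hT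
    have vS : volume S = ENNReal.ofReal (1 - a) * volume A' := by
      rw [hS, Set.image_add_left, measure_preimage_add, Measure.addHaar_smul]
      simp [abs_of_pos (by linarith : 0 < 1 - a)]
    have vT : volume T = ENNReal.ofReal a * volume B' := by
      rw [hT, Set.image_add_left, measure_preimage_add, Measure.addHaar_smul]
      simp [abs_of_pos ha]
    have cT : IsCompact T := (cB.smul a).image (by fun_prop)
    have hST : S ∩ T ⊆ {(1 - a) * p + a * q} := by
      rintro z ⟨⟨_, ⟨x, hx, rfl⟩, rfl⟩, ⟨_, ⟨y, hy, rfl⟩, hz⟩⟩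
      have h1 : x ≤ p := hpm hx
      have h2 : q ≤ y := hqm hy
      simp only [smul_eq_mul, Set.mem_singleton_iff] at *
      have h3 : (1 - a) * x ≤ (1 - a) * p := mul_le_mul_of_nonneg_left h1 (by linarith)
      have h4 : a * q ≤ a * y := mul_le_mul_of_nonneg_left h2 ha.le
      linarith
    have hd : AEDisjoint volume S T := measure_mono_null hST (by simp)
    rw [← vS, ← vT, ← measure_union₀ cT.measurableSet.nullMeasurableSet hd]
    apply measure_mono
    rintro z (⟨_, ⟨x, hx, rfl⟩, rfl⟩ | ⟨_, ⟨y, hy, rfl⟩, rfl⟩)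
    · simpa [add_comm] using hC x (hA' hx) q (hB' hq)
    · simpa using hC p (hA' hp) y (hB' hy)
  obtain ⟨x0, hx0⟩ := hAn
  obtain ⟨y0, hy0⟩ := hBn
  have key2 : ∀ A' ⊆ A, IsCompact A' → ∀ B' ⊆ B, IsCompact B' →
      ENNReal.ofReal (1 - a) * volume A' + ENNReal.ofReal a * volume B' ≤ volume C := by
    intro A' hA' cA B' hB' cB
    refine le_trans ?_ (key (insert x0 A') (Set.insert_subset hx0 hA') (cA.insert x0)
      (insert y0 B') (Set.insert_subset hy0 hB') (cB.insert y0) ⟨x0, by simp⟩ ⟨y0, by simp⟩)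
    gcongr <;> exact Set.subset_insert _ _
  rw [hA.measure_eq_iSup_isCompact, hB.measure_eq_iSup_isCompact]
  simp only [ENNReal.mul_iSup]
  have e0 : ∀ D : Set ℝ, (∅ : Set ℝ) ⊆ D ∧ IsCompact (∅ : Set ℝ) := fun D => ⟨by simp, by simp⟩
  simp only [iSup_and']
  refine ENNReal.biSup_add_biSup_le' ⟨∅, e0 A⟩ ⟨∅, e0 B⟩ ?_
  intro A' h1 B' h2
  exact key2 A' h1.1 h1.2 B' h2.1 h2.2

theorem ennreal_amgm {a : ℝ} (ha : 0 < a) (ha1 : a < 1) (x y : ENNReal) :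
    x ^ (1 - a) * y ^ a ≤ ENNReal.ofReal (1 - a) * x + ENNReal.ofReal a * y := by
  have h1a : 0 < 1 - a := by linarith
  by_cases hx : x = ⊤
  · subst hx
    rw [ENNReal.mul_top (by simpa using ha1)]; simp
  by_cases hy : y = ⊤
  · subst hy
    rw [ENNReal.mul_top (by simpa using ha)]; simp
  lift x to NNReal using hx
  lift y to NNReal using hy
  have := NNReal.geom_mean_le_arith_mean2_weighted (1 - a).toNNReal a.toNNReal x y
    (by rw [← Real.toNNReal_add h1a.le ha.le]; simp)
  rw [Real.coe_toNNReal _ h1a.le, Real.coe_toNNReal _ ha.le] at this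
  rw [← ENNReal.coe_rpow_of_nonneg _ h1a.le, ← ENNReal.coe_rpow_of_nonneg _ ha.le,
    ENNReal.ofReal, ENNReal.ofReal]
  exact_mod_cast this

theorem pl_norm {f g h : ℝ → ℝ} {a : ℝ} (ha : 0 < a) (ha1 : a < 1)
    (mf : Measurable f) (mg : Measurable g) (mh : Measurable h)
    (f0 : ∀ x, 0 ≤ f x) (g0 : ∀ x, 0 ≤ g x) (h0 : ∀ x, 0 ≤ h x)
    (f1 : ∀ x, f x ≤ 1) (g1 : ∀ x, g x ≤ 1)
    (fs : ∀ s < 1, ∃ x, s < f x) (gs : ∀ s < 1, ∃ x, s < g x)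
    (H : ∀ x y, min (f x) (g y) ≤ h ((1 - a) * x + a * y)) :
    ENNReal.ofReal (1 - a) * (∫⁻ x, ENNReal.ofReal (f x)) +
      ENNReal.ofReal a * (∫⁻ x, ENNReal.ofReal (g x)) ≤ ∫⁻ x, ENNReal.ofReal (h x) := by
  rw [lintegral_eq_lintegral_meas_lt volume (ae_of_all _ f0) mf.aemeasurable,
    lintegral_eq_lintegral_meas_lt volume (ae_of_all _ g0) mg.aemeasurable,
    lintegral_eq_lintegral_meas_lt volume (ae_of_all _ h0) mh.aemeasurable]
  have anti : ∀ k : ℝ → ℝ, Measurable (fun t => volume {x | t < k x}) := by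
    intro k
    apply Antitone.measurable
    intro s t hst
    exact measure_mono fun x hx => lt_of_le_of_lt hst hx
  rw [← lintegral_const_mul _ (anti f), ← lintegral_const_mul _ (anti g),
    ← lintegral_add_left ((anti f).const_mul _)]
  apply lintegral_mono
  intro t
  by_cases ht : t < 1
  · apply bm_one ha ha1 (measurableSet_lt measurable_const mf)
      (measurableSet_lt measurable_const mg) (fs t ht) (gs t ht)
    intro x hx y hy
    exact lt_of_lt_of_le (lt_min hx hy) (H x y)
  · have e1 : {x | t < f x} = ∅ := by
      ext x; simp; linarith [f1 x]
    have e2 : {x | t < g x} = ∅ := by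
      ext x; simp; linarith [g1 x]
    simp [e1, e2]

/-- Prekopa-Leindler on a space. -/
def PL (E : Type*) [AddCommGroup E] [Module ℝ E] [MeasureSpace E] : Prop :=
  ∀ (f g h : E → ENNReal) (a : ℝ), 0 < a → a < 1 → Measurable f → Measurable g → Measurable h →
    (∀ x y, f x ^ (1 - a) * g y ^ a ≤ h ((1 - a) • x + a • y)) →
    (∫⁻ x, f x) ^ (1 - a) * (∫⁻ x, g x) ^ a ≤ ∫⁻ x, h x

theorem pl_bdd (f g h : ℝ → ENNReal) (a : ℝ) (ha : 0 < a) (ha1 : a < 1)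
    (mf : Measurable f) (mg : Measurable g) (mh : Measurable h)
    (hF : (⨆ x, f x) ≠ ⊤) (hG : (⨆ x, g x) ≠ ⊤)
    (H : ∀ x y, f x ^ (1 - a) * g y ^ a ≤ h ((1 - a) • x + a • y)) :
    (∫⁻ x, f x) ^ (1 - a) * (∫⁻ x, g x) ^ a ≤ ∫⁻ x, h x := by
  have h1a : 0 < 1 - a := by linarith
  set F := ⨆ x, f x with hFd
  set G := ⨆ x, g x with hGd
  have fF : ∀ x, f x ≤ F := le_iSup f
  have gG : ∀ x, g x ≤ G := le_iSup g
  by_cases hF0 : F = 0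
  · have : ∀ x, f x = 0 := fun x => le_antisymm ((fF x).trans hF0.le) zero_le
    simp [this, ENNReal.zero_rpow_of_pos h1a]
  by_cases hG0 : G = 0
  · have : ∀ x, g x = 0 := fun x => le_antisymm ((gG x).trans hG0.le) zero_le
    simp [this, ENNReal.zero_rpow_of_pos ha]
  set N := F ^ (1 - a) * G ^ a with hN
  have hN0 : N ≠ 0 := by
    simp [hN, ENNReal.rpow_eq_zero_iff, hF0, hG0, hF, hG]
  have hNt : N ≠ ⊤ := by
    apply ENNReal.mul_ne_top
    · exact ENNReal.rpow_ne_top_of_nonneg h1a.le hF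
    · exact ENNReal.rpow_ne_top_of_nonneg ha.le hG
  have hf1 : ∀ x, f x / F ≤ 1 := fun x => ENNReal.div_le_of_le_mul (by simpa using fF x)
  have hg1 : ∀ x, g x / G ≤ 1 := fun x => ENNReal.div_le_of_le_mul (by simpa using gG x)
  have hh1 : ∀ x, min (h x / N) 1 ≤ 1 := fun x => min_le_right _ _
  have sup_aux : ∀ (k : ℝ → ENNReal), (⨆ x, k x) ≠ 0 → (⨆ x, k x) ≠ ⊤ → (∀ x, k x / (⨆ x, k x) ≤ 1) →
      ∀ s < (1:ℝ), ∃ x, s < (k x / (⨆ x, k x)).toReal := by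
    intro k k0 kt k1 s hs
    by_contra hcon
    push Not at hcon
    have h2 : ∀ x, k x ≤ ENNReal.ofReal s * (⨆ x, k x) := by
      intro x
      rw [← ENNReal.div_le_iff k0 kt]
      rw [← ENNReal.ofReal_toReal (ne_top_of_le_ne_top ENNReal.one_ne_top (k1 x))]
      exact ENNReal.ofReal_le_ofReal (hcon x)
    have h3 : (⨆ x, k x) ≤ ENNReal.ofReal s * (⨆ x, k x) := iSup_le h2
    have h4 : ENNReal.ofReal s * (⨆ x, k x) < 1 * (⨆ x, k x) := by
      rw [ENNReal.mul_lt_mul_iff_left k0 kt]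
      simpa using hs
    rw [one_mul] at h4
    exact absurd h3 (not_le.mpr h4)
  have main := pl_norm (f := fun x => (f x / F).toReal) (g := fun x => (g x / G).toReal)
    (h := fun x => (min (h x / N) 1).toReal) ha ha1
    (by fun_prop) (by fun_prop) (by fun_prop)
    (fun _ => ENNReal.toReal_nonneg) (fun _ => ENNReal.toReal_nonneg) (fun _ => ENNReal.toReal_nonneg)
    (fun x => by simpa using ENNReal.toReal_mono ENNReal.one_ne_top (hf1 x))
    (fun x => by simpa using ENNReal.toReal_mono ENNReal.one_ne_top (hg1 x))
    (sup_aux f hF0 hF hf1) (sup_aux g hG0 hG hg1) (by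
      intro x y
      have t1 := ne_top_of_le_ne_top ENNReal.one_ne_top (hf1 x)
      have t2 := ne_top_of_le_ne_top ENNReal.one_ne_top (hg1 y)
      rw [← ENNReal.toReal_min t1 t2]
      apply ENNReal.toReal_mono (ne_top_of_le_ne_top ENNReal.one_ne_top (hh1 _))
      apply le_min _ ((min_le_left _ _).trans (hf1 x))
      set m := min (f x / F) (g y / G) with hm
      have hm1 : m ≤ f x / F := min_le_left _ _
      have hm2 : m ≤ g y / G := min_le_right _ _
      have : m = m ^ (1 - a) * m ^ a := by
        rw [← ENNReal.rpow_add_of_nonneg _ _ h1a.le ha.le]; simp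
      rw [this]
      calc m ^ (1 - a) * m ^ a ≤ (f x / F) ^ (1 - a) * (g y / G) ^ a := by
            gcongr
        _ = (f x ^ (1 - a) * g y ^ a) / N := by
            rw [ENNReal.div_rpow_of_nonneg _ _ h1a.le, ENNReal.div_rpow_of_nonneg _ _ ha.le,
              hN, div_eq_mul_inv, div_eq_mul_inv, div_eq_mul_inv,
              ENNReal.mul_inv (Or.inr (ENNReal.rpow_ne_top_of_nonneg ha.le hG))
                (Or.inl (ENNReal.rpow_ne_top_of_nonneg h1a.le hF))]
            ring
        _ ≤ _ := by
            apply ENNReal.div_le_div_right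
            simpa using H x y)
  have ef : ∀ x, ENNReal.ofReal ((f x / F).toReal) = f x / F := fun x =>
    ENNReal.ofReal_toReal (ne_top_of_le_ne_top ENNReal.one_ne_top (hf1 x))
  have eg : ∀ x, ENNReal.ofReal ((g x / G).toReal) = g x / G := fun x =>
    ENNReal.ofReal_toReal (ne_top_of_le_ne_top ENNReal.one_ne_top (hg1 x))
  have eh : ∀ x, ENNReal.ofReal ((min (h x / N) 1).toReal) ≤ h x / N := fun x => by
    rw [ENNReal.ofReal_toReal (ne_top_of_le_ne_top ENNReal.one_ne_top (hh1 x))]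
    exact min_le_left _ _
  simp only [ef, eg] at main
  have m2 := (ennreal_amgm ha ha1 _ _).trans (main.trans (lintegral_mono eh))
  simp only [div_eq_mul_inv] at m2
  rw [lintegral_mul_const _ mf, lintegral_mul_const _ mg, lintegral_mul_const _ mh,
    ← div_eq_mul_inv, ← div_eq_mul_inv, ← div_eq_mul_inv,
    ENNReal.div_rpow_of_nonneg _ _ h1a.le, ENNReal.div_rpow_of_nonneg _ _ ha.le] at m2
  have m3 : ((∫⁻ x, f x) ^ (1 - a) * (∫⁻ x, g x) ^ a) / N ≤ (∫⁻ x, h x) / N := by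
    refine le_trans (le_of_eq ?_) m2
    rw [hN, div_eq_mul_inv, div_eq_mul_inv, div_eq_mul_inv,
              ENNReal.mul_inv (Or.inr (ENNReal.rpow_ne_top_of_nonneg ha.le hG))
                (Or.inl (ENNReal.rpow_ne_top_of_nonneg h1a.le hF))]
    ring
  rw [ENNReal.div_le_iff hN0 hNt, ENNReal.div_mul_cancel hN0 hNt] at m3
  exact m3

theorem pl_real : PL ℝ := by
  intro f g h a ha ha1 mf mg mh H
  have h1a : 0 < 1 - a := by linarith
  have sup : ∀ (k : ℝ → ENNReal), Measurable k → ∫⁻ x, k x = ⨆ n : ℕ, ∫⁻ x, min (k x) n := by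
    intro k mk
    rw [← lintegral_iSup (fun n => mk.min measurable_const)]
    · congr 1
      ext x
      rw [← inf_iSup_eq, ENNReal.iSup_natCast]; simp
    · intro n m hnm x
      exact min_le_min_left _ (by exact_mod_cast hnm)
  have rsup : ∀ (b : ℝ), 0 < b → ∀ k : ℕ → ENNReal, (⨆ n, k n) ^ b = ⨆ n, (k n) ^ b := by
    intro b hb k
    exact (ENNReal.orderIsoRpow b hb).map_iSup k
  rw [sup f mf, sup g mg, rsup _ h1a, rsup _ ha, ENNReal.iSup_mul]
  refine iSup_le fun n => ?_
  rw [ENNReal.mul_iSup]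
  refine iSup_le fun m => ?_
  apply pl_bdd _ _ h a ha ha1 (mf.min measurable_const) (mg.min measurable_const) mh
  · exact ne_top_of_le_ne_top (ENNReal.natCast_ne_top n) (iSup_le fun x => min_le_right _ _)
  · exact ne_top_of_le_ne_top (ENNReal.natCast_ne_top m) (iSup_le fun x => min_le_right _ _)
  · intro x y
    refine le_trans ?_ (H x y)
    gcongr
    · exact min_le_left _ _
    · exact min_le_left _ _

theorem pl_prod {E F : Type*} [AddCommGroup E] [Module ℝ E] [MeasureSpace E]
    [AddCommGroup F] [Module ℝ F] [MeasureSpace F] [SFinite (volume : Measure E)]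
    [SFinite (volume : Measure F)]
    (hE : PL E) (hF : PL F) : PL (E × F) := by
  intro f g h a ha ha1 mf mg mh H
  rw [Measure.volume_eq_prod, lintegral_prod _ mf.aemeasurable, lintegral_prod _ mg.aemeasurable,
    lintegral_prod _ mh.aemeasurable]
  apply hE _ _ _ a ha ha1 mf.lintegral_prod_right' mg.lintegral_prod_right'
    mh.lintegral_prod_right'
  intro x y
  apply hF _ _ _ a ha ha1 (by fun_prop) (by fun_prop) (by fun_prop)
  intro z w
  exact H (x, z) (y, w)

theorem pl_pi (n : ℕ) : PL (Fin n → ℝ) := by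
  induction n with
  | zero =>
    intro f g h a ha ha1 mf mg mh H
    rw [volume_pi, Measure.pi_of_empty _ (fun i => (0:ℝ))]
    rw [lintegral_dirac' _ mf, lintegral_dirac' _ mg, lintegral_dirac' _ mh]
    convert H _ _ using 2
  | succ n ih =>
    intro f g h a ha ha1 mf mg mh H
    have mp := (volume_preserving_piFinSuccAbove (fun _ : Fin (n + 1) => ℝ) 0).symm
    rw [← mp.lintegral_comp mf, ← mp.lintegral_comp mg, ← mp.lintegral_comp mh]
    apply pl_prod pl_real ih _ _ _ a ha ha1 (mf.comp (MeasurableEquiv.measurable _))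
      (mg.comp (MeasurableEquiv.measurable _)) (mh.comp (MeasurableEquiv.measurable _))
    intro x y
    refine (H _ _).trans (le_of_eq ?_)
    simp only [Function.comp]
    congr 1
    ext i
    refine Fin.cases ?_ (fun j => ?_) i <;> simp [MeasurableEquiv.piFinSuccAbove]

theorem cross_two {f g : ℝ → ℝ} {W : ℝ} (hW : 0 < W)
    (If : IntervalIntegrable f volume 0 W) (Ig : IntervalIntegrable g volume 0 W)
    (h0 : ∫ t in (0:ℝ)..W, f t = ∫ t in (0:ℝ)..W, g t)
    (h1 : ∫ t in (0:ℝ)..W, t * f t = ∫ t in (0:ℝ)..W, t * g t)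
    (hS : ∀ x y z, 0 < x → x < z → z < y → y < W → f x < g x → f y < g y → f z ≤ g z) :
    ∫ t in (0:ℝ)..W, t ^ 2 * g t ≤ ∫ t in (0:ℝ)..W, t ^ 2 * f t := by
  set S : Set ℝ := {t | 0 < t ∧ t < W ∧ f t < g t} with hSd
  have pat : ∃ p q : ℝ, ∀ t, 0 < t → t < W → 0 ≤ (t - p) * (t - q) * (f t - g t) := by
    by_cases hne : S.Nonempty
    · have bb : BddBelow S := ⟨0, fun x hx => hx.1.le⟩
      have ba : BddAbove S := ⟨W, fun x hx => hx.2.1.le⟩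
      refine ⟨sInf S, sSup S, fun t ht0 htW => ?_⟩
      have hle : sInf S ≤ sSup S := Real.sInf_le_sSup S bb ba
      rcases lt_or_ge t (sInf S) with h | h
      · have : g t ≤ f t := by
          by_contra hc
          exact absurd (csInf_le bb (⟨ht0, htW, not_le.mp hc⟩ : t ∈ S)) (not_le.mpr h)
        apply mul_nonneg (mul_nonneg_of_nonpos_of_nonpos (by linarith) (by linarith)) (by linarith)
      rcases lt_or_ge (sSup S) t with h' | h'
      · have : g t ≤ f t := by
          by_contra hc
          exact absurd (le_csSup ba (⟨ht0, htW, not_le.mp hc⟩ : t ∈ S)) (not_le.mpr h')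
        apply mul_nonneg (mul_nonneg (by linarith) (by linarith)) (by linarith)
      rcases eq_or_lt_of_le h with h2 | h2
      · rw [← h2]; simp
      rcases eq_or_lt_of_le h' with h3 | h3
      · rw [← h3]; simp
      obtain ⟨x, hx, hxt⟩ := exists_lt_of_csInf_lt hne h2
      obtain ⟨y, hy, hyt⟩ := exists_lt_of_lt_csSup hne h3
      have := hS x y t hx.1 hxt hyt hy.2.1 hx.2.2 hy.2.2
      apply mul_nonneg_of_nonpos_of_nonpos _ (by linarith)
      exact mul_nonpos_of_nonneg_of_nonpos (by linarith) (by linarith)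
    · refine ⟨0, 0, fun t ht0 htW => ?_⟩
      have : g t ≤ f t := by
        by_contra hc
        exact hne ⟨t, ht0, htW, not_le.mp hc⟩
      apply mul_nonneg (mul_self_nonneg _) (by linarith)
  obtain ⟨p, q, hpq⟩ := pat
  have I1 : ∀ k : ℝ → ℝ, IntervalIntegrable k volume 0 W →
      IntervalIntegrable (fun t => t * k t) volume 0 W := fun k hk =>
    hk.continuousOn_mul continuousOn_id
  have I2 : ∀ k : ℝ → ℝ, IntervalIntegrable k volume 0 W →
      IntervalIntegrable (fun t => t ^ 2 * k t) volume 0 W := fun k hk =>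
    hk.continuousOn_mul (by fun_prop)
  have E : ∀ k : ℝ → ℝ, IntervalIntegrable k volume 0 W →
      ∫ t in (0:ℝ)..W, (t - p) * (t - q) * k t = (∫ t in (0:ℝ)..W, t ^ 2 * k t)
        - (p + q) * (∫ t in (0:ℝ)..W, t * k t) + p * q * ∫ t in (0:ℝ)..W, k t := by
    intro k hk
    rw [← intervalIntegral.integral_const_mul, ← intervalIntegral.integral_const_mul,
      ← intervalIntegral.integral_sub (I2 k hk) ((I1 k hk).const_mul _),
      ← intervalIntegral.integral_add ((I2 k hk).sub ((I1 k hk).const_mul _)) (hk.const_mul _)]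
    congr 1; ext t; ring
  have J : ∀ k : ℝ → ℝ, IntervalIntegrable k volume 0 W →
      IntervalIntegrable (fun t => (t - p) * (t - q) * k t) volume 0 W := fun k hk =>
    hk.continuousOn_mul (by fun_prop)
  have hm := intervalIntegral.integral_mono_on_of_le_Ioo hW.le (J g Ig) (J f If) (by
    intro t ht
    have := hpq t ht.1 ht.2
    linarith)
  rw [E f If, E g Ig, h0, h1] at hm
  linarith

theorem cross_one {f g : ℝ → ℝ} {W : ℝ} (hW : 0 < W)
    (If : IntervalIntegrable f volume 0 W) (Ig : IntervalIntegrable g volume 0 W)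
    (h0 : ∫ t in (0:ℝ)..W, f t = ∫ t in (0:ℝ)..W, g t)
    (hS : ∀ x y, 0 < x → x < y → y < W → f y < g y → f x ≤ g x) :
    ∫ t in (0:ℝ)..W, t * g t ≤ ∫ t in (0:ℝ)..W, t * f t := by
  set S : Set ℝ := {t | 0 < t ∧ t < W ∧ f t < g t} with hSd
  have pat : ∃ p : ℝ, ∀ t, 0 < t → t < W → 0 ≤ (t - p) * (f t - g t) := by
    by_cases hne : S.Nonempty
    · have ba : BddAbove S := ⟨W, fun x hx => hx.2.1.le⟩
      refine ⟨sSup S, fun t ht0 htW => ?_⟩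
      rcases lt_or_ge (sSup S) t with h' | h'
      · have : g t ≤ f t := by
          by_contra hc
          exact absurd (le_csSup ba (⟨ht0, htW, not_le.mp hc⟩ : t ∈ S)) (not_le.mpr h')
        apply mul_nonneg (by linarith) (by linarith)
      rcases eq_or_lt_of_le h' with h3 | h3
      · rw [← h3]; simp
      obtain ⟨y, hy, hyt⟩ := exists_lt_of_lt_csSup hne h3
      have := hS t y ht0 hyt hy.2.1 hy.2.2
      exact mul_nonneg_of_nonpos_of_nonpos (by linarith) (by linarith)
    · refine ⟨0, fun t ht0 htW => ?_⟩
      have : g t ≤ f t := by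
        by_contra hc
        exact hne ⟨t, ht0, htW, not_le.mp hc⟩
      apply mul_nonneg (by linarith) (by linarith)
  obtain ⟨p, hpq⟩ := pat
  have I1 : ∀ k : ℝ → ℝ, IntervalIntegrable k volume 0 W →
      IntervalIntegrable (fun t => t * k t) volume 0 W := fun k hk =>
    hk.continuousOn_mul continuousOn_id
  have E : ∀ k : ℝ → ℝ, IntervalIntegrable k volume 0 W →
      ∫ t in (0:ℝ)..W, (t - p) * k t = (∫ t in (0:ℝ)..W, t * k t)
        - p * ∫ t in (0:ℝ)..W, k t := by
    intro k hk
    rw [← intervalIntegral.integral_const_mul,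
      ← intervalIntegral.integral_sub (I1 k hk) (hk.const_mul _)]
    congr 1; ext t; ring
  have J : ∀ k : ℝ → ℝ, IntervalIntegrable k volume 0 W →
      IntervalIntegrable (fun t => (t - p) * k t) volume 0 W := fun k hk =>
    hk.continuousOn_mul (by fun_prop)
  have hm := intervalIntegral.integral_mono_on_of_le_Ioo hW.le (J g Ig) (J f If) (by
    intro t ht
    have := hpq t ht.1 ht.2
    linarith)
  rw [E f If, E g Ig, h0] at hm
  linarith

/-- Double cone profile with apex slice at height `s`. -/
noncomputable def coneProf (n : ℕ) (W s t : ℝ) : ℝ :=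
  if t ≤ s then (t / s) ^ n else ((W - t) / (W - s)) ^ n

theorem half_int (n k : ℕ) (s : ℝ) :
    ∫ t in (0:ℝ)..s, t ^ k * (t / s) ^ n = s ^ (k + 1) / (n + k + 1) := by
  by_cases hs : s = 0
  · subst hs; simp
  have : ∀ t : ℝ, t ^ k * (t / s) ^ n = (s ^ n)⁻¹ * t ^ (n + k) := by
    intro t; rw [div_pow]; field_simp; ring
  simp only [this]
  rw [intervalIntegral.integral_const_mul, integral_pow]
  push_cast
  have : (n : ℝ) + k + 1 ≠ 0 := by positivity
  field_simp
  simp; ring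

theorem coneProf_int_gen (n : ℕ) {W s : ℝ} (h0 : 0 ≤ s) (hs : s ≤ W) (φ : ℝ → ℝ)
    (hφ : Continuous φ) :
    IntervalIntegrable (fun t => φ t * coneProf n W s t) volume 0 W ∧
    ∫ t in (0:ℝ)..W, φ t * coneProf n W s t =
      (∫ t in (0:ℝ)..s, φ t * (t / s) ^ n) +
      ∫ r in (0:ℝ)..(W - s), φ (W - r) * (r / (W - s)) ^ n := by
  have c1 : Continuous (fun t : ℝ => φ t * (t / s) ^ n) := by fun_prop
  have c2 : Continuous (fun t : ℝ => φ t * ((W - t) / (W - s)) ^ n) := by fun_prop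
  have e1 : Set.EqOn (fun t => φ t * (t / s) ^ n) (fun t => φ t * coneProf n W s t)
      (Set.uIoc 0 s) := by
    intro t ht
    rw [Set.uIoc_of_le h0] at ht
    simp [coneProf, ht.2]
  have e2 : Set.EqOn (fun t => φ t * ((W - t) / (W - s)) ^ n) (fun t => φ t * coneProf n W s t)
      (Set.uIoc s W) := by
    intro t ht
    rw [Set.uIoc_of_le hs] at ht
    simp [coneProf, ht.1]
  have i1 : IntervalIntegrable (fun t => φ t * coneProf n W s t) volume 0 s :=
    (c1.intervalIntegrable 0 s).congr e1
  have i2 : IntervalIntegrable (fun t => φ t * coneProf n W s t) volume s W :=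
    (c2.intervalIntegrable s W).congr e2
  refine ⟨i1.trans i2, ?_⟩
  rw [← intervalIntegral.integral_add_adjacent_intervals i1 i2]
  congr 1
  · apply intervalIntegral.integral_congr_ae
    exact ae_of_all _ fun t ht => (e1 ht).symm
  · have h3 : ∫ t in s..W, φ t * coneProf n W s t =
        ∫ t in s..W, φ t * ((W - t) / (W - s)) ^ n := by
      apply intervalIntegral.integral_congr_ae
      exact ae_of_all _ fun t ht => (e2 ht).symm
    rw [h3]
    have := intervalIntegral.integral_comp_sub_left (a := s) (b := W)
      (fun r => φ (W - r) * (r / (W - s)) ^ n) W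
    simp only [sub_sub_cancel, sub_self] at this
    exact this

theorem coneProf_intble (n : ℕ) {W s : ℝ} (h0 : 0 ≤ s) (hs : s ≤ W) :
    IntervalIntegrable (coneProf n W s) volume 0 W := by
  simpa using (coneProf_int_gen n h0 hs (fun _ => 1) continuous_const).1

theorem coneProf_int0 (n : ℕ) {W s : ℝ} (h0 : 0 ≤ s) (hs : s ≤ W) :
    ∫ t in (0:ℝ)..W, coneProf n W s t = W / (n + 1) := by
  have := (coneProf_int_gen n h0 hs (fun _ => 1) continuous_const).2
  simp only [one_mul] at this
  have a1 := half_int n 0 s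
  have a2 := half_int n 0 (W - s)
  simp only [pow_zero, one_mul] at a1 a2
  rw [this, a1, a2]
  have : (n : ℝ) + 1 ≠ 0 := by positivity
  simp; field_simp; ring

theorem coneProf_int1 (n : ℕ) {W s : ℝ} (h0 : 0 ≤ s) (hs : s ≤ W) :
    ∫ t in (0:ℝ)..W, t * coneProf n W s t = W / (n + 1) * ((W + n * s) / (n + 2)) := by
  have := (coneProf_int_gen n h0 hs (fun t => t) continuous_id).2
  have a1 := half_int n 1 s
  have a2 := half_int n 0 (W - s)
  have a3 := half_int n 1 (W - s)
  simp only [pow_zero, pow_one, one_mul] at a1 a2 a3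
  have e : ∫ r in (0:ℝ)..(W - s), (W - r) * (r / (W - s)) ^ n =
      W * (∫ r in (0:ℝ)..(W - s), (r / (W - s)) ^ n)
        - ∫ r in (0:ℝ)..(W - s), r * (r / (W - s)) ^ n := by
    rw [← intervalIntegral.integral_const_mul, ← intervalIntegral.integral_sub]
    · congr 1; ext r; ring
    · apply Continuous.intervalIntegrable; fun_prop
    · apply Continuous.intervalIntegrable; fun_prop
  rw [this, e, a1, a2, a3]
  have : (n : ℝ) + 1 ≠ 0 := by positivity
  have : (n : ℝ) + 2 ≠ 0 := by positivity
  have : (n : ℝ) + 1 + 1 ≠ 0 := by positivity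
  push_cast
  field_simp
  ring

theorem coneProf_int2 (n : ℕ) {W s : ℝ} (h0 : 0 ≤ s) (hs : s ≤ W) :
    ∫ t in (0:ℝ)..W, t ^ 2 * coneProf n W s t =
      s ^ 3 / (n + 3) + (W ^ 2 * (W - s) / (n + 1) - 2 * W * (W - s) ^ 2 / (n + 2)
        + (W - s) ^ 3 / (n + 3)) := by
  have := (coneProf_int_gen n h0 hs (fun t => t ^ 2) (by fun_prop)).2
  have a1 := half_int n 2 s
  have a2 := half_int n 0 (W - s)
  have a3 := half_int n 1 (W - s)
  have a4 := half_int n 2 (W - s)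
  simp only [pow_zero, pow_one, one_mul] at a1 a2 a3 a4
  have e : ∫ r in (0:ℝ)..(W - s), (W - r) ^ 2 * (r / (W - s)) ^ n =
      W ^ 2 * (∫ r in (0:ℝ)..(W - s), (r / (W - s)) ^ n)
        - 2 * W * (∫ r in (0:ℝ)..(W - s), r * (r / (W - s)) ^ n)
        + ∫ r in (0:ℝ)..(W - s), r ^ 2 * (r / (W - s)) ^ n := by
    rw [← intervalIntegral.integral_const_mul, ← intervalIntegral.integral_const_mul,
      ← intervalIntegral.integral_sub, ← intervalIntegral.integral_add]
    · congr 1; ext r; ring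
    all_goals apply Continuous.intervalIntegrable; fun_prop
  rw [this, e, a1, a2, a3, a4]
  have : (n : ℝ) + 1 ≠ 0 := by positivity
  have : (n : ℝ) + 2 ≠ 0 := by positivity
  have : (n : ℝ) + 3 ≠ 0 := by positivity
  have : (n : ℝ) + 1 + 1 ≠ 0 := by positivity
  have : (n : ℝ) + 2 + 1 ≠ 0 := by positivity
  push_cast
  field_simp
  ring

theorem mean_range (n : ℕ) {f : ℝ → ℝ} {W : ℝ} (hW : 0 < W)
    (If : IntervalIntegrable f volume 0 W)
    (hL : ∀ s t, 0 < s → s < t → t < W → s ^ n * f t ≤ t ^ n * f s)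
    (hR : ∀ s t, 0 < s → s < t → t < W → (W - t) ^ n * f s ≤ (W - s) ^ n * f t) :
    W / (n + 2) * (∫ t in (0:ℝ)..W, f t) ≤ ∫ t in (0:ℝ)..W, t * f t ∧
    ∫ t in (0:ℝ)..W, t * f t ≤ W * (n + 1) / (n + 2) * (∫ t in (0:ℝ)..W, f t) := by
  set V := ∫ t in (0:ℝ)..W, f t with hV
  have n1 : (n : ℝ) + 1 ≠ 0 := by positivity
  have n2 : (n : ℝ) + 2 ≠ 0 := by positivity
  set A := V * (n + 1) / W with hA
  have key : ∀ s, 0 ≤ s → s ≤ W → (∫ t in (0:ℝ)..W, A * coneProf n W s t = V) ∧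
      (∫ t in (0:ℝ)..W, t * (A * coneProf n W s t) = V * ((W + n * s) / (n + 2))) := by
    intro s h0 hs
    constructor
    · rw [intervalIntegral.integral_const_mul, coneProf_int0 n h0 hs, hA]; field_simp
    · have : ∀ t, t * (A * coneProf n W s t) = A * (t * coneProf n W s t) := fun t => by ring
      simp only [this]
      rw [intervalIntegral.integral_const_mul, coneProf_int1 n h0 hs, hA]; field_simp
  constructor
  · obtain ⟨k0, k1⟩ := key 0 le_rfl hW.le
    have := cross_one hW If ((coneProf_intble n le_rfl hW.le).const_mul A) (k0.symm ▸ rfl) (by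
      intro x y hx hxy hy h
      have hx' : ¬ x ≤ 0 := not_le.mpr hx
      have hy' : ¬ y ≤ 0 := not_le.mpr (hx.trans hxy)
      simp only [coneProf, hx', hy', if_false, sub_zero, div_pow] at h ⊢
      have p1 : 0 < (W - y) ^ n := pow_pos (by linarith) n
      have p2 : 0 < (W - x) ^ n := pow_pos (by linarith) n
      have p3 : 0 < W ^ n := pow_pos hW n
      have := hR x y hx hxy hy
      have h2 : (W - x) ^ n * f y ≤ (W - x) ^ n * (A * ((W - y) ^ n / W ^ n)) :=
        mul_le_mul_of_nonneg_left h.le p2.le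
      refine le_of_mul_le_mul_left (this.trans (h2.trans (le_of_eq ?_))) p1
      ring)
    rw [k1] at this
    refine le_trans (le_of_eq ?_) this
    simp; ring
  · obtain ⟨k0, k1⟩ := key W hW.le le_rfl
    have := cross_one hW ((coneProf_intble n hW.le le_rfl).const_mul A) If (k0 ▸ rfl) (by
      intro x y hx hxy hy h
      have hx' : x ≤ W := by linarith
      have hy' : y ≤ W := by linarith
      simp only [coneProf, hx', hy', if_true, div_pow] at h ⊢
      have p1 : 0 < x ^ n := pow_pos hx n
      have p2 : 0 < y ^ n := pow_pos (hx.trans hxy) n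
      have p3 : 0 < W ^ n := pow_pos hW n
      have := hL x y hx hxy hy
      have h2 : x ^ n * (A * (y ^ n / W ^ n)) ≤ x ^ n * f y :=
        mul_le_mul_of_nonneg_left h.le p1.le
      refine le_of_mul_le_mul_left (le_trans (le_of_eq ?_) (h2.trans this)) p2
      ring)
    rw [k1] at this
    refine this.trans (le_of_eq ?_)
    ring

theorem lower_1d (n : ℕ) {f : ℝ → ℝ} {W : ℝ} (hW : 0 < W)
    (If : IntervalIntegrable f volume 0 W) (hVpos : 0 < ∫ t in (0:ℝ)..W, f t)
    (hL : ∀ s t, 0 < s → s < t → t < W → s ^ n * f t ≤ t ^ n * f s)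
    (hR : ∀ s t, 0 < s → s < t → t < W → (W - t) ^ n * f s ≤ (W - s) ^ n * f t) :
    W ^ 2 / (2 * (n + 2) * (n + 3)) * (∫ t in (0:ℝ)..W, f t) ≤
      (∫ t in (0:ℝ)..W, t ^ 2 * f t) -
        (∫ t in (0:ℝ)..W, t * f t) ^ 2 / (∫ t in (0:ℝ)..W, f t) := by
  obtain ⟨r1, r2⟩ := mean_range n hW If hL hR
  set V := ∫ t in (0:ℝ)..W, f t with hV
  set M := ∫ t in (0:ℝ)..W, t * f t with hM
  have n1 : (n : ℝ) + 1 ≠ 0 := by positivity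
  have n2 : (n : ℝ) + 2 ≠ 0 := by positivity
  have n3 : (n : ℝ) + 3 ≠ 0 := by positivity
  have n2p : (0:ℝ) < n + 2 := by positivity
  have hs : ∃ s, 0 ≤ s ∧ s ≤ W ∧ V * ((W + n * s) / (n + 2)) = M := by
    rcases Nat.eq_zero_or_pos n with hn | hn
    · subst hn
      refine ⟨0, le_rfl, hW.le, ?_⟩
      simp at r1 r2 ⊢
      linarith
    · have hn' : (0:ℝ) < n := by exact_mod_cast hn
      refine ⟨((n + 2) * (M / V) - W) / n, ?_, ?_, ?_⟩
      · apply div_nonneg _ hn'.le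
        rw [div_mul_eq_mul_div, div_le_iff₀ n2p] at r1
        have : W ≤ (n + 2) * (M / V) := by
          rw [mul_div_assoc', le_div_iff₀ hVpos]; linarith
        linarith
      · rw [div_le_iff₀ hn']
        rw [div_mul_eq_mul_div, le_div_iff₀ n2p] at r2
        have : (n + 2) * (M / V) ≤ W * (n + 1) := by
          rw [mul_div_assoc', div_le_iff₀ hVpos]; linarith
        linarith
      · field_simp; ring
  obtain ⟨s, h0, hsW, hsM⟩ := hs
  set A := V * (n + 1) / W with hA
  have k0 : ∫ t in (0:ℝ)..W, A * coneProf n W s t = V := by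
    rw [intervalIntegral.integral_const_mul, coneProf_int0 n h0 hsW, hA]; field_simp
  have k1 : ∫ t in (0:ℝ)..W, t * (A * coneProf n W s t) = M := by
    have : ∀ t, t * (A * coneProf n W s t) = A * (t * coneProf n W s t) := fun t => by ring
    simp only [this]
    rw [intervalIntegral.integral_const_mul, coneProf_int1 n h0 hsW, hA, ← hsM]; field_simp
  have := cross_two hW If ((coneProf_intble n h0 hsW).const_mul A) (k0 ▸ rfl) (k1 ▸ rfl) (by
    intro x y z hx hxz hzy hy hfx hfy
    rcases le_or_gt z s with hz | hz
    · have hxs : x ≤ s := by linarith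
      simp only [coneProf, hxs, hz, if_true, div_pow] at hfx ⊢
      have p1 : 0 < x ^ n := pow_pos hx n
      have p2 : 0 < z ^ n := pow_pos (hx.trans hxz) n
      have := hL x z hx hxz (by linarith)
      refine le_of_mul_le_mul_left (this.trans
        ((mul_le_mul_of_nonneg_left hfx.le p2.le).trans (le_of_eq ?_))) p1
      ring
    · have hys : ¬ y ≤ s := by linarith
      simp only [coneProf, hys, not_le.mpr hz, if_false, div_pow] at hfy ⊢
      have p1 : 0 < (W - y) ^ n := pow_pos (by linarith) n
      have p2 : 0 < (W - z) ^ n := pow_pos (by linarith) n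
      have := hR z y (by linarith) hzy hy
      refine le_of_mul_le_mul_left (this.trans
        ((mul_le_mul_of_nonneg_left hfy.le p2.le).trans (le_of_eq ?_))) p1
      ring)
  have e2 : ∫ t in (0:ℝ)..W, t ^ 2 * (A * coneProf n W s t) =
      A * (s ^ 3 / (n + 3) + (W ^ 2 * (W - s) / (n + 1) - 2 * W * (W - s) ^ 2 / (n + 2)
        + (W - s) ^ 3 / (n + 3))) := by
    rw [← coneProf_int2 n h0 hsW, ← intervalIntegral.integral_const_mul]
    congr 1; ext t; ring
  rw [e2] at this
  refine le_trans ?_ (sub_le_sub_right this _)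
  rw [← hsM, ← sub_nonneg]
  have : A * (s ^ 3 / (n + 3) + (W ^ 2 * (W - s) / (n + 1) - 2 * W * (W - s) ^ 2 / (n + 2)
        + (W - s) ^ 3 / (n + 3))) - (V * ((W + n * s) / (n + 2))) ^ 2 / V
        - W ^ 2 / (2 * (n + 2) * (n + 3)) * V
      = V * (n * (W - 2 * s) ^ 2) / (2 * (n + 2) ^ 2 * (n + 3)) := by
    rw [hA]; field_simp; ring
  rw [this]; positivity

theorem cosh_ineq_aux {z : ℝ} (hz : 0 ≤ z) :
    0 ≤ 5 * z ^ 2 + 12 + (z ^ 2 - 12) * Real.cosh z := by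
  have mono : ∀ (F F' : ℝ → ℝ), (∀ x, HasDerivAt F (F' x) x) → (∀ x, 0 ≤ x → 0 ≤ F' x) → F 0 = 0 →
      ∀ x, 0 ≤ x → 0 ≤ F x := by
    intro F F' hd hp h0 x hx
    have : MonotoneOn F (Set.Ici 0) := by
      apply monotoneOn_of_deriv_nonneg (convex_Ici 0)
      · exact fun y _ => (hd y).continuousAt.continuousWithinAt
      · exact fun y _ => (hd y).differentiableAt.differentiableWithinAt
      · intro y hy
        rw [interior_Ici] at hy
        rw [(hd y).deriv]
        exact hp y (le_of_lt hy)
    rw [← h0]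
    exact this (by simp) hx hx
  have dq : ∀ x : ℝ, HasDerivAt (fun x : ℝ => x ^ 2) (2 * x) x := fun x => by
    simpa using hasDerivAt_pow 2 x
  have s0 : ∀ x : ℝ, 0 ≤ x → 0 ≤ x * Real.cosh x - Real.sinh x :=
    mono _ (fun x => x * Real.sinh x) (fun x => by
      have := ((hasDerivAt_id x).mul (Real.hasDerivAt_cosh x)).sub (Real.hasDerivAt_sinh x)
      refine this.congr_deriv ?_
      simp) (fun x hx => mul_nonneg hx (Real.sinh_nonneg_iff.mpr hx)) (by simp)
  have s1 : ∀ x : ℝ, 0 ≤ x →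
      0 ≤ 10 - 10 * Real.cosh x + 4 * (x * Real.sinh x) + x ^ 2 * Real.cosh x :=
    mono _ (fun x => -6 * Real.sinh x + 6 * x * Real.cosh x + x ^ 2 * Real.sinh x) (fun x => by
      have := ((((Real.hasDerivAt_cosh x).const_mul 10).const_sub 10).add
        (((hasDerivAt_id x).mul (Real.hasDerivAt_sinh x)).const_mul 4)).add
        ((dq x).mul (Real.hasDerivAt_cosh x))
      refine this.congr_deriv ?_
      simp; ring) (fun x hx => by
        have a := s0 x hx
        have b := mul_nonneg (sq_nonneg x) (Real.sinh_nonneg_iff.mpr hx)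
        linarith) (by simp)
  have s2 : ∀ x : ℝ, 0 ≤ x →
      0 ≤ 10 * x + 2 * (x * Real.cosh x) + (x ^ 2 - 12) * Real.sinh x :=
    mono _ (fun x => 10 - 10 * Real.cosh x + 4 * (x * Real.sinh x) + x ^ 2 * Real.cosh x) (fun x => by
      have := (((hasDerivAt_id x).const_mul 10).add
        (((hasDerivAt_id x).mul (Real.hasDerivAt_cosh x)).const_mul 2)).add
        (((dq x).sub_const 12).mul (Real.hasDerivAt_sinh x))
      refine this.congr_deriv ?_
      simp; ring) s1 (by simp)
  exact mono (fun z => 5 * z ^ 2 + 12 + (z ^ 2 - 12) * Real.cosh z)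
    (fun x => 10 * x + 2 * (x * Real.cosh x) + (x ^ 2 - 12) * Real.sinh x) (fun x => by
      have := (((dq x).const_mul 5).add_const 12).add
        (((dq x).sub_const 12).mul (Real.hasDerivAt_cosh x))
      refine this.congr_deriv ?_
      ring) s2 (by simp) z hz

theorem cosh_ineq (z : ℝ) : 0 ≤ 5 * z ^ 2 + 12 + (z ^ 2 - 12) * Real.cosh z := by
  have := cosh_ineq_aux (abs_nonneg z)
  simpa [Real.cosh_abs] using this

theorem exp_var (W l : ℝ) :
    (∫ t in (0:ℝ)..W, t ^ 2 * Real.exp (l * t)) * (∫ t in (0:ℝ)..W, Real.exp (l * t))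
      - (∫ t in (0:ℝ)..W, t * Real.exp (l * t)) ^ 2 ≤
      W ^ 2 / 12 * (∫ t in (0:ℝ)..W, Real.exp (l * t)) ^ 2 := by
  by_cases hl : l = 0
  · subst hl
    simp
    apply le_of_eq; ring
  have de : ∀ t : ℝ, HasDerivAt (fun t => Real.exp (l * t)) (l * Real.exp (l * t)) t := fun t => by
    have := ((hasDerivAt_id t).const_mul l).exp
    refine this.congr_deriv ?_
    simp; ring
  have i0 : ∫ t in (0:ℝ)..W, Real.exp (l * t) = (Real.exp (l * W) - 1) / l := by
    rw [intervalIntegral.integral_eq_sub_of_hasDerivAt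
      (f := fun t => l⁻¹ * Real.exp (l * t))]
    · simp; ring
    · intro t _
      refine ((de t).const_mul l⁻¹).congr_deriv ?_
      field_simp
    · apply Continuous.intervalIntegrable; fun_prop
  have i1 : ∫ t in (0:ℝ)..W, t * Real.exp (l * t) =
      (l * W * Real.exp (l * W) - Real.exp (l * W) + 1) / l ^ 2 := by
    rw [intervalIntegral.integral_eq_sub_of_hasDerivAt
      (f := fun t => (t / l - 1 / l ^ 2) * Real.exp (l * t))]
    · simp; field_simp
    · intro t _
      refine ((((hasDerivAt_id t).div_const l).sub_const (1 / l ^ 2)).mul (de t)).congr_deriv ?_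
      simp; field_simp; ring
    · apply Continuous.intervalIntegrable; fun_prop
  have i2 : ∫ t in (0:ℝ)..W, t ^ 2 * Real.exp (l * t) =
      ((l * W) ^ 2 * Real.exp (l * W) - 2 * (l * W) * Real.exp (l * W)
        + 2 * Real.exp (l * W) - 2) / l ^ 3 := by
    rw [intervalIntegral.integral_eq_sub_of_hasDerivAt
      (f := fun t => (t ^ 2 / l - 2 / l ^ 2 * t + 2 / l ^ 3) * Real.exp (l * t))]
    · simp; field_simp
    · intro t _
      have dq : HasDerivAt (fun x : ℝ => x ^ 2) (2 * t) t := by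
        simpa using hasDerivAt_pow 2 t
      refine ((((dq.div_const l).sub ((hasDerivAt_id t).const_mul (2 / l ^ 2))).add_const
        (2 / l ^ 3)).mul (de t)).congr_deriv ?_
      simp; field_simp; ring
    · apply Continuous.intervalIntegrable; fun_prop
  rw [i0, i1, i2]
  set z := l * W with hz
  have hE := Real.exp_pos z
  have hc := cosh_ineq z
  rw [Real.cosh_eq, Real.exp_neg] at hc
  set E := Real.exp z with hEd
  have hW : W = z / l := by rw [hz]; field_simp
  rw [hW, ← sub_nonneg]
  have : (z / l) ^ 2 / 12 * ((E - 1) / l) ^ 2 -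
      ((z ^ 2 * E - 2 * z * E + 2 * E - 2) / l ^ 3 * ((E - 1) / l) - ((z * E - E + 1) / l ^ 2) ^ 2)
      = (2 * E * (5 * z ^ 2 + 12 + (z ^ 2 - 12) * ((E + E⁻¹) / 2))) / (12 * l ^ 4) := by
    field_simp; ring
  rw [this]; positivity

theorem exists_tilt {W c : ℝ} (h0 : 0 < c) (hc : c < W) :
    ∃ l : ℝ, ∫ t in (0:ℝ)..W, (t - c) * Real.exp (l * (t - c)) = 0 := by
  set F : ℝ → ℝ := fun l => ∫ t in (0:ℝ)..W, (t - c) * Real.exp (l * (t - c)) with hF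
  have cF : Continuous F := by
    apply intervalIntegral.continuous_parametric_intervalIntegral_of_continuous'
    fun_prop
  have ii : ∀ l p q : ℝ, IntervalIntegrable (fun t => (t - c) * Real.exp (l * (t - c))) volume p q :=
    fun l p q => by apply Continuous.intervalIntegrable; fun_prop
  have split : ∀ l, F l = (∫ t in (0:ℝ)..c, (t - c) * Real.exp (l * (t - c))) +
      ∫ t in c..W, (t - c) * Real.exp (l * (t - c)) := fun l =>
    (intervalIntegral.integral_add_adjacent_intervals (ii l 0 c) (ii l c W)).symm
  have P3 : 0 < (W - c) ^ 3 := pow_pos (by linarith) 3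
  have Q3 : 0 < c ^ 3 := pow_pos h0 3
  have pos : ∃ l, 0 ≤ F l := by
    set l := 3 * c ^ 2 / (W - c) ^ 3 with hl
    have l0 : 0 ≤ l := by positivity
    refine ⟨l, ?_⟩
    have a1 : ∫ t in (0:ℝ)..c, (t - c) ≤ ∫ t in (0:ℝ)..c, (t - c) * Real.exp (l * (t - c)) := by
      apply intervalIntegral.integral_mono_on h0.le (by apply Continuous.intervalIntegrable; fun_prop)
        (ii l 0 c)
      intro t ht
      have : Real.exp (l * (t - c)) ≤ 1 := Real.exp_le_one_iff.mpr
        (mul_nonpos_of_nonneg_of_nonpos l0 (by linarith [ht.2]))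
      nlinarith [ht.2]
    have a2 : ∫ t in c..W, l * (t - c) ^ 2 ≤ ∫ t in c..W, (t - c) * Real.exp (l * (t - c)) := by
      apply intervalIntegral.integral_mono_on hc.le (by apply Continuous.intervalIntegrable; fun_prop)
        (ii l c W)
      intro t ht
      have := Real.add_one_le_exp (l * (t - c))
      nlinarith [ht.1]
    have b1 : ∫ t in (0:ℝ)..c, (t - c) = - c ^ 2 / 2 := by
      rw [intervalIntegral.integral_comp_sub_right (fun t => t)]; simp
    have b2 : ∫ t in c..W, l * (t - c) ^ 2 = c ^ 2 := by
      rw [intervalIntegral.integral_const_mul,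
        intervalIntegral.integral_comp_sub_right (fun t => t ^ 2)]
      have hne : W - c ≠ 0 := by linarith
      simp [hl]; field_simp; norm_num
    rw [split]; nlinarith
  have neg : ∃ l, F l ≤ 0 := by
    set k := 3 * (W - c) ^ 2 / c ^ 3 with hl
    have l0 : 0 ≤ k := by positivity
    refine ⟨-k, ?_⟩
    have a1 : ∫ t in c..W, (t - c) * Real.exp (-k * (t - c)) ≤ ∫ t in c..W, (t - c) := by
      apply intervalIntegral.integral_mono_on hc.le (ii (-k) c W)
        (by apply Continuous.intervalIntegrable; fun_prop)
      intro t ht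
      have : Real.exp (-k * (t - c)) ≤ 1 := Real.exp_le_one_iff.mpr
        (mul_nonpos_of_nonpos_of_nonneg (by linarith) (by linarith [ht.1]))
      nlinarith [ht.1]
    have a2 : ∫ t in (0:ℝ)..c, (t - c) * Real.exp (-k * (t - c)) ≤ ∫ t in (0:ℝ)..c, -k * (t - c) ^ 2 := by
      apply intervalIntegral.integral_mono_on h0.le (ii (-k) 0 c)
        (by apply Continuous.intervalIntegrable; fun_prop)
      intro t ht
      have := Real.add_one_le_exp (-k * (t - c))
      nlinarith [ht.2]
    have b1 : ∫ t in c..W, (t - c) = (W - c) ^ 2 / 2 := by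
      rw [intervalIntegral.integral_comp_sub_right (fun t => t)]; simp
    have b2 : ∫ t in (0:ℝ)..c, -k * (t - c) ^ 2 = - (W - c) ^ 2 := by
      rw [intervalIntegral.integral_const_mul,
        intervalIntegral.integral_comp_sub_right (fun t => t ^ 2)]
      simp [hl]; field_simp; ring
    rw [split]; nlinarith
  obtain ⟨p, hp⟩ := pos
  obtain ⟨q, hq⟩ := neg
  exact mem_range_of_exists_le_of_exists_ge cF ⟨q, hq⟩ ⟨p, hp⟩

theorem upper_1d {f : ℝ → ℝ} {W : ℝ} (hW : 0 < W)
    (If : IntervalIntegrable f volume 0 W) (hVpos : 0 < ∫ t in (0:ℝ)..W, f t)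
    (hM0 : 0 < ∫ t in (0:ℝ)..W, t * f t)
    (hM1 : ∫ t in (0:ℝ)..W, t * f t < W * ∫ t in (0:ℝ)..W, f t)
    (hS : ∀ C l : ℝ, 0 < C → ∀ x y z, 0 < x → x < z → z < y → y < W →
      C * Real.exp (l * x) < f x → C * Real.exp (l * y) < f y → C * Real.exp (l * z) ≤ f z) :
      (∫ t in (0:ℝ)..W, t ^ 2 * f t) -
        (∫ t in (0:ℝ)..W, t * f t) ^ 2 / (∫ t in (0:ℝ)..W, f t) ≤
    W ^ 2 / 12 * (∫ t in (0:ℝ)..W, f t) := by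
  set V := ∫ t in (0:ℝ)..W, f t with hV
  set M := ∫ t in (0:ℝ)..W, t * f t with hM
  obtain ⟨l, hl⟩ := exists_tilt (div_pos hM0 hVpos) ((div_lt_iff₀ hVpos).mpr hM1)
  have ev := exp_var W l
  have c0 : IntervalIntegrable (fun t => Real.exp (l * t)) volume 0 W := by
    apply Continuous.intervalIntegrable; fun_prop
  have c1 : IntervalIntegrable (fun t => t * Real.exp (l * t)) volume 0 W := by
    apply Continuous.intervalIntegrable; fun_prop
  have hI0 : 0 < ∫ t in (0:ℝ)..W, Real.exp (l * t) :=
    intervalIntegral.intervalIntegral_pos_of_pos c0 (fun t => Real.exp_pos _) hW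
  set I0 := ∫ t in (0:ℝ)..W, Real.exp (l * t) with hI0d
  set I1 := ∫ t in (0:ℝ)..W, t * Real.exp (l * t) with hI1d
  set I2 := ∫ t in (0:ℝ)..W, t ^ 2 * Real.exp (l * t) with hI2d
  have h1 : I1 = M / V * I0 := by
    have : ∫ t in (0:ℝ)..W, (t - M / V) * Real.exp (l * (t - M / V)) =
        Real.exp (- l * (M / V)) * (I1 - M / V * I0) := by
      rw [hI1d, hI0d, ← intervalIntegral.integral_const_mul,
        ← intervalIntegral.integral_sub c1 (c0.const_mul _), ← intervalIntegral.integral_const_mul]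
      congr 1; ext t
      have : l * (t - M / V) = -l * (M / V) + l * t := by ring
      rw [this, Real.exp_add]; ring
    rw [this] at hl
    have := (mul_eq_zero.mp hl).resolve_left (Real.exp_pos _).ne'
    linarith
  set C := V / I0 with hC
  have hCp : 0 < C := div_pos hVpos hI0
  have := cross_two (f := fun t => C * Real.exp (l * t)) (g := f) hW (c0.const_mul C) If
    (by rw [intervalIntegral.integral_const_mul, ← hI0d, hC]; field_simp; exact hV)
    (by
      have : ∀ t : ℝ, t * (C * Real.exp (l * t)) = C * (t * Real.exp (l * t)) := fun t => by ring
      simp only [this]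
      rw [intervalIntegral.integral_const_mul, ← hI1d, h1, hC]; field_simp; exact hM)
    (hS C l hCp)
  have e2 : ∫ t in (0:ℝ)..W, t ^ 2 * (C * Real.exp (l * t)) = C * I2 := by
    rw [hI2d, ← intervalIntegral.integral_const_mul]
    congr 1; ext t; ring
  rw [e2] at this
  refine (sub_le_sub_right this _).trans ?_
  rw [h1] at ev
  have h3 : C * I2 - M ^ 2 / V = (V / I0 ^ 2) * (I2 * I0 - (M / V * I0) ^ 2) := by
    rw [hC]; field_simp
  rw [h3]
  refine (mul_le_mul_of_nonneg_left ev (by positivity)).trans (le_of_eq ?_)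
  field_simp

theorem exists_Phi (n : ℕ) (u : EuclideanSpace ℝ (Fin (n + 1))) (hu : ‖u‖ = 1) :
    ∃ Φ : EuclideanSpace ℝ (Fin (n + 1)) ≃L[ℝ] ℝ × (Fin n → ℝ),
      MeasurePreserving Φ ∧ (∀ x, (Φ x).1 = ⟪x, u⟫) ∧ Φ u = (1, 0) := by
  have hv : Orthonormal ℝ (({0} : Set (Fin (n + 1))).domRestrict (fun _ => u)) := by
    constructor
    · intro i; exact hu
    · intro i j hij
      exact absurd (Subsingleton.elim i j) hij
  obtain ⟨b, hb⟩ := hv.exists_orthonormalBasis_extension_of_card_eq (by simp)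
  have hb0 : b 0 = u := hb 0 (by simp)
  let L : (Fin (n + 1) → ℝ) ≃ₗ[ℝ] ℝ × (Fin n → ℝ) :=
    { toFun := fun x => (x 0, fun j => x j.succ)
      invFun := fun z => Fin.cons z.1 z.2
      map_add' := fun x y => rfl
      map_smul' := fun c x => rfl
      left_inv := fun x => by
        ext i; refine Fin.cases ?_ (fun j => ?_) i <;> simp
      right_inv := fun z => by simp }
  let Ψ : EuclideanSpace ℝ (Fin (n + 1)) ≃ₗ[ℝ] ℝ × (Fin n → ℝ) :=
    (b.repr.toLinearEquiv.trans (WithLp.linearEquiv 2 ℝ (Fin (n + 1) → ℝ))).trans L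
  refine ⟨Ψ.toContinuousLinearEquiv, ?_, ?_, ?_⟩
  · have m1 := b.measurePreserving_repr
    have m2 := PiLp.volume_preserving_ofLp (Fin (n + 1))
    have m3 := volume_preserving_piFinSuccAbove (fun _ : Fin (n + 1) => ℝ) 0
    exact m3.comp (m2.comp m1)
  · intro x
    change (b.repr x) 0 = _
    rw [b.repr_apply_apply, hb0, real_inner_comm]
  · change ((b.repr u) 0, fun j : Fin n => (b.repr u) j.succ) = _
    rw [← hb0, b.repr_self]
    ext <;> simp

section slices

variable {n : ℕ} {u : EuclideanSpace ℝ (Fin (n + 1))}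
  {Φ : EuclideanSpace ℝ (Fin (n + 1)) ≃L[ℝ] ℝ × (Fin n → ℝ)}

/-- slice volume. -/
def slv (Φ : EuclideanSpace ℝ (Fin (n + 1)) ≃L[ℝ] ℝ × (Fin n → ℝ))
    (K : Set (EuclideanSpace ℝ (Fin (n + 1)))) (t : ℝ) : ℝ :=
  (volume (Prod.mk t ⁻¹' (Φ '' K))).toReal

theorem slice_fin {K : Set (EuclideanSpace ℝ (Fin (n + 1)))} (hK : IsCompact K) (t : ℝ) :
    volume (Prod.mk t ⁻¹' (Φ '' K)) ≠ ⊤ := by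
  have hc : IsCompact (Prod.snd '' (Φ '' K)) := (hK.image Φ.continuous).image continuous_snd
  refine ne_top_of_le_ne_top hc.measure_lt_top.ne (measure_mono ?_)
  intro y hy
  exact ⟨(t, y), hy, rfl⟩

theorem red_int (mp : MeasurePreserving Φ) (h1 : ∀ x, (Φ x).1 = ⟪x, u⟫)
    {K : Set (EuclideanSpace ℝ (Fin (n + 1)))} (hK : IsCompact K) {m W : ℝ} (hW : 0 ≤ W)
    (hm : ∀ x ∈ K, m ≤ ⟪x, u⟫ ∧ ⟪x, u⟫ ≤ m + W) (φ : ℝ → ℝ) (hφ : Continuous φ) :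
    IntervalIntegrable (fun t => φ (m + t) * slv Φ K (m + t)) volume 0 W ∧
    ∫ x in K, φ ⟪x, u⟫ = ∫ t in (0:ℝ)..W, φ (m + t) * slv Φ K (m + t) := by
  have cK : IsCompact (Φ '' K) := hK.image Φ.continuous
  have mK := cK.measurableSet
  have e1 : ∫ x in K, φ ⟪x, u⟫ = ∫ z in Φ '' K, φ z.1 := by
    rw [mp.setIntegral_image_emb Φ.toHomeomorph.measurableEmbedding]
    simp only [h1]
  have int1 : Integrable ((Φ '' K).indicator (fun z => φ z.1)) (volume.prod volume) := by
    rw [← Measure.volume_eq_prod, integrable_indicator_iff mK]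
    exact (Continuous.continuousOn (by fun_prop)).integrableOn_compact cK
  have inner : ∀ t, ∫ y, (Φ '' K).indicator (fun z => φ z.1) (t, y) = φ t * slv Φ K t := by
    intro t
    have : ∀ y, (Φ '' K).indicator (fun z => φ z.1) (t, y) =
        (Prod.mk t ⁻¹' (Φ '' K)).indicator (fun _ => φ t) y := by
      intro y; simp only [Set.indicator]; rfl
    simp only [this]
    rw [integral_indicator_const _ (measurable_prodMk_left mK)]
    simp [slv, Measure.real, mul_comm]
  have e2 : ∫ z in Φ '' K, φ z.1 = ∫ t, φ t * slv Φ K t := by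
    rw [← integral_indicator mK, Measure.volume_eq_prod, integral_prod _ int1]
    simp only [inner]
  have int2 : Integrable (fun t => φ t * slv Φ K t) := by
    have := int1.integral_prod_left
    simpa only [inner] using this
  have int3 : Integrable (fun t => φ (m + t) * slv Φ K (m + t)) := int2.comp_add_left m
  have zero : ∀ t, t ∉ Set.Icc 0 W → φ (m + t) * slv Φ K (m + t) = 0 := by
    intro t ht
    have : Prod.mk (m + t) ⁻¹' (Φ '' K) = ∅ := by
      ext y
      simp only [Set.mem_preimage, Set.mem_empty_iff_false, iff_false]
      rintro ⟨x, hx, hxy⟩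
      have a := h1 x
      have b := hm x hx
      rw [hxy] at a
      simp only at a
      exact ht ⟨by linarith, by linarith⟩
    simp [slv, this]
  refine ⟨int3.intervalIntegrable, ?_⟩
  rw [e1, e2, ← integral_add_left_eq_self _ m,
    ← setIntegral_eq_integral_of_forall_compl_eq_zero zero, integral_Icc_eq_integral_Ioc,
    intervalIntegral.integral_of_le hW]

theorem red_moment (mp : MeasurePreserving Φ) (h1 : ∀ x, (Φ x).1 = ⟪x, u⟫)
    {K : Set (EuclideanSpace ℝ (Fin (n + 1)))} (hK : IsCompact K) (hi : (interior K).Nonempty)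
    {m W : ℝ} (hW : 0 ≤ W)
    (hm : ∀ x ∈ K, m ≤ ⟪x, u⟫ ∧ ⟪x, u⟫ ≤ m + W) :
    IntervalIntegrable (fun t => slv Φ K (m + t)) volume 0 W ∧
    0 < ∫ t in (0:ℝ)..W, slv Φ K (m + t) ∧
    (volume K).toReal = ∫ t in (0:ℝ)..W, slv Φ K (m + t) ∧
    momentOfInertia u K = (∫ t in (0:ℝ)..W, t ^ 2 * slv Φ K (m + t)) -
      (∫ t in (0:ℝ)..W, t * slv Φ K (m + t)) ^ 2 / ∫ t in (0:ℝ)..W, slv Φ K (m + t) := by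
  have r := fun φ hφ => red_int mp h1 hK hW hm φ hφ
  have I0 : IntervalIntegrable (fun t => slv Φ K (m + t)) volume 0 W := by
    simpa using (r (fun _ => 1) continuous_const).1
  have hV : (volume K).toReal = ∫ t in (0:ℝ)..W, slv Φ K (m + t) := by
    have := (r (fun _ => 1) continuous_const).2
    simpa [Measure.real] using this
  have hpos : 0 < (volume K).toReal := by
    apply ENNReal.toReal_pos
    · exact (lt_of_lt_of_le (isOpen_interior.measure_pos volume hi)
        (measure_mono interior_subset)).ne'
    · exact hK.measure_lt_top.ne
  have hpos' := hpos
  rw [hV] at hpos'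
  refine ⟨I0, hpos', hV, ?_⟩
  set f : ℝ → ℝ := fun t => slv Φ K (m + t) with hf
  have I1 : IntervalIntegrable (fun t => t * f t) volume 0 W :=
    I0.continuousOn_mul continuousOn_id
  have I2 : IntervalIntegrable (fun t => t ^ 2 * f t) volume 0 W :=
    I0.continuousOn_mul (by fun_prop)
  have hc : ⟪centroid K, u⟫ = m + (∫ t in (0:ℝ)..W, t * f t) / ∫ t in (0:ℝ)..W, f t := by
    have hint : Integrable (fun x : EuclideanSpace ℝ (Fin (n + 1)) => x) (volume.restrict K) :=
      continuous_id.continuousOn.integrableOn_compact hK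
    rw [centroid, real_inner_smul_left, real_inner_comm, ← integral_inner hint u]
    have : ∫ x in K, ⟪u, x⟫ = ∫ x in K, ⟪x, u⟫ := by
      congr 1; ext x; exact real_inner_comm _ _
    rw [this, (r (fun t => t) continuous_id).2, hV]
    have e : ∫ t in (0:ℝ)..W, (m + t) * f t = m * (∫ t in (0:ℝ)..W, f t)
        + ∫ t in (0:ℝ)..W, t * f t := by
      rw [← intervalIntegral.integral_const_mul, ← intervalIntegral.integral_add (I0.const_mul m) I1]
      congr 1; ext t; ring
    rw [e]
    field_simp
  set V := ∫ t in (0:ℝ)..W, f t with hVd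
  set M := ∫ t in (0:ℝ)..W, t * f t with hMd
  have : momentOfInertia u K = ∫ x in K, (fun s => (s - (m + M / V)) ^ 2) ⟪x, u⟫ := by
    rw [momentOfInertia]
    congr 1; ext x
    rw [inner_sub_left, hc]
  rw [this, (r (fun s => (s - (m + M / V)) ^ 2) (by fun_prop)).2]
  have e : ∫ t in (0:ℝ)..W, (m + t - (m + M / V)) ^ 2 * f t =
      (∫ t in (0:ℝ)..W, t ^ 2 * f t) - 2 * (M / V) * (∫ t in (0:ℝ)..W, t * f t) +
        (M / V) ^ 2 * ∫ t in (0:ℝ)..W, f t := by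
    rw [← intervalIntegral.integral_const_mul, ← intervalIntegral.integral_const_mul,
      ← intervalIntegral.integral_sub I2 (I1.const_mul _),
      ← intervalIntegral.integral_add (I2.sub (I1.const_mul _)) (I0.const_mul _)]
    congr 1; ext t; ring
  rw [e, ← hVd, ← hMd]
  field_simp
  ring

theorem slv_star {K : Set (EuclideanSpace ℝ (Fin (n + 1)))} (hK : IsCompact K)
    (hcv : Convex ℝ K) (h1 : ∀ x, (Φ x).1 = ⟪x, u⟫) {p : EuclideanSpace ℝ (Fin (n + 1))}
    (hp : p ∈ K) {a : ℝ} (ha : 0 < a) (ha1 : a < 1) (t : ℝ) :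
    a ^ n * slv Φ K t ≤ slv Φ K ((1 - a) * ⟪p, u⟫ + a * t) := by
  have cv : Convex ℝ (Φ '' K) := hcv.linear_image Φ.toLinearMap
  have hsub : (fun y => (1 - a) • (Φ p).2 + y) '' (a • (Prod.mk t ⁻¹' (Φ '' K))) ⊆
      Prod.mk ((1 - a) * ⟪p, u⟫ + a * t) ⁻¹' (Φ '' K) := by
    rintro _ ⟨_, ⟨y, hy, rfl⟩, rfl⟩
    have := cv (Set.mem_image_of_mem Φ hp) hy (by linarith : 0 ≤ 1 - a) ha.le (by ring)
    rw [Set.mem_preimage]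
    convert this using 1
    ext
    · simp [h1]
    · simp
  have hle := measure_mono (μ := volume) hsub
  rw [Set.image_add_left, measure_preimage_add, Measure.addHaar_smul] at hle
  have := ENNReal.toReal_mono (slice_fin hK _) hle
  rw [ENNReal.toReal_mul] at this
  simpa [slv, abs_of_pos ha, ENNReal.toReal_ofReal (pow_nonneg ha.le n)] using this

theorem slv_logconcave {K : Set (EuclideanSpace ℝ (Fin (n + 1)))} (hK : IsCompact K)
    (hcv : Convex ℝ K) {a : ℝ} (ha : 0 < a) (ha1 : a < 1) (s t : ℝ) :
    slv Φ K s ^ (1 - a) * slv Φ K t ^ a ≤ slv Φ K ((1 - a) * s + a * t) := by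
  have cv : Convex ℝ (Φ '' K) := hcv.linear_image Φ.toLinearMap
  have mK : MeasurableSet (Φ '' K) := (hK.image Φ.continuous).measurableSet
  have h1a : 0 < 1 - a := by linarith
  have ms : ∀ t : ℝ, MeasurableSet (Prod.mk t ⁻¹' (Φ '' K)) := fun t => measurable_prodMk_left mK
  have := pl_pi n ((Prod.mk s ⁻¹' (Φ '' K)).indicator 1) ((Prod.mk t ⁻¹' (Φ '' K)).indicator 1)
    ((Prod.mk ((1 - a) * s + a * t) ⁻¹' (Φ '' K)).indicator 1) a ha ha1
    (measurable_one.indicator (ms s)) (measurable_one.indicator (ms t))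
    (measurable_one.indicator (ms _)) (by
      intro x y
      by_cases hx : x ∈ Prod.mk s ⁻¹' (Φ '' K)
      · by_cases hy : y ∈ Prod.mk t ⁻¹' (Φ '' K)
        · have hz : (1 - a) • x + a • y ∈ Prod.mk ((1 - a) * s + a * t) ⁻¹' (Φ '' K) := by
            have := cv hx hy h1a.le ha.le (by ring)
            rw [Set.mem_preimage]
            convert this using 1
            simp
          rw [Set.indicator_of_mem hx, Set.indicator_of_mem hy, Set.indicator_of_mem hz]
          simp
        · rw [Set.indicator_of_notMem hy, ENNReal.zero_rpow_of_pos ha]; simp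
      · rw [Set.indicator_of_notMem hx, ENNReal.zero_rpow_of_pos h1a]; simp)
  rw [lintegral_indicator_one (ms _), lintegral_indicator_one (ms _),
    lintegral_indicator_one (ms _)] at this
  have := ENNReal.toReal_mono (slice_fin hK _) this
  rw [ENNReal.toReal_mul, ← ENNReal.toReal_rpow, ← ENNReal.toReal_rpow] at this
  exact this

theorem body_bounds (mp : MeasurePreserving Φ) (h1 : ∀ x, (Φ x).1 = ⟪x, u⟫)
    {K : Set (EuclideanSpace ℝ (Fin (n + 1)))} (hcv : Convex ℝ K) (hK : IsCompact K)
    (hi : (interior K).Nonempty) :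
      dirWidth u K ^ 2 / (2 * (n + 2) * (n + 3))
          ≤ momentOfInertia u K / (volume K).toReal ∧
      momentOfInertia u K / (volume K).toReal ≤ dirWidth u K ^ 2 / 12 := by
  have cI : IsCompact ((fun x => ⟪x, u⟫) '' K) := hK.image (by fun_prop)
  have nI : ((fun x => ⟪x, u⟫) '' K).Nonempty := (hi.mono interior_subset).image _
  obtain ⟨p, hpK, hp⟩ := cI.sInf_mem nI
  obtain ⟨q, hqK, hq⟩ := cI.sSup_mem nI
  simp only at hp hq
  set W := dirWidth u K with hWd
  have hWd' : sSup ((fun x => ⟪x, u⟫) '' K) = sInf ((fun x => ⟪x, u⟫) '' K) + W := by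
    rw [hWd, dirWidth]; ring
  set m := sInf ((fun x => ⟪x, u⟫) '' K) with hmd
  rw [hWd'] at hq
  have hm : ∀ x ∈ K, m ≤ ⟪x, u⟫ ∧ ⟪x, u⟫ ≤ m + W := by
    intro x hx
    refine ⟨csInf_le cI.bddBelow ⟨x, hx, rfl⟩, ?_⟩
    rw [← hWd']
    exact le_csSup cI.bddAbove ⟨x, hx, rfl⟩
  have hW0 : 0 ≤ W := by have := hm p hpK; linarith
  obtain ⟨If, hVpos, hV, hI⟩ := red_moment mp h1 hK hi hW0 hm
  have hW : 0 < W := by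
    rcases hW0.eq_or_lt with h | h
    · rw [← h] at hVpos; simp at hVpos
    · exact h
  have hL : ∀ s t, 0 < s → s < t → t < W →
      s ^ n * slv Φ K (m + t) ≤ t ^ n * slv Φ K (m + s) := by
    intro s t hs hst ht
    have ht0 : 0 < t := hs.trans hst
    have := slv_star hK hcv h1 hpK (div_pos hs ht0) ((div_lt_one ht0).mpr hst) (m + t)
    have e : (1 - s / t) * ⟪p, u⟫ + s / t * (m + t) = m + s := by
      rw [hp]; field_simp; ring
    rw [e, div_pow, div_mul_eq_mul_div, div_le_iff₀ (pow_pos ht0 n)] at this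
    linarith
  have hR : ∀ s t, 0 < s → s < t → t < W →
      (W - t) ^ n * slv Φ K (m + s) ≤ (W - s) ^ n * slv Φ K (m + t) := by
    intro s t hs hst ht
    have ht0 : 0 < W - t := by linarith
    have hs0 : 0 < W - s := by linarith
    have := slv_star hK hcv h1 hqK (div_pos ht0 hs0) ((div_lt_one hs0).mpr (by linarith)) (m + s)
    have e : (1 - (W - t) / (W - s)) * ⟪q, u⟫ + (W - t) / (W - s) * (m + s) = m + t := by
      rw [hq]; field_simp; ring
    rw [e, div_pow, div_mul_eq_mul_div, div_le_iff₀ (pow_pos hs0 n)] at this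
    linarith
  obtain ⟨r1, r2⟩ := mean_range n hW If hL hR
  rw [hV, hI]
  constructor
  · rw [le_div_iff₀ hVpos]
    exact lower_1d n hW If hVpos hL hR
  · rw [div_le_iff₀ hVpos]
    apply upper_1d hW If hVpos
    · exact lt_of_lt_of_le (by positivity) r1
    · refine lt_of_le_of_lt r2 ?_
      apply mul_lt_mul_of_pos_right _ hVpos
      rw [div_lt_iff₀ (by positivity)]
      nlinarith
    · intro C l hC x y z hx hxz hzy hy hfx hfy
      have hyx : 0 < y - x := by linarith
      set a := (z - x) / (y - x) with ha
      have ha0 : 0 < a := div_pos (by linarith) hyx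
      have ha1 : a < 1 := (div_lt_one hyx).mpr (by linarith)
      have hz : z = (1 - a) * x + a * y := by rw [ha]; field_simp; ring
      have h1a : 0 < 1 - a := by linarith
      have := slv_logconcave (Φ := Φ) hK hcv ha0 ha1 (m + x) (m + y)
      have e : (1 - a) * (m + x) + a * (m + y) = m + z := by rw [hz]; ring
      rw [e] at this
      refine le_trans ?_ this
      have e3 : C * Real.exp (l * z) =
          (C * Real.exp (l * x)) ^ (1 - a) * (C * Real.exp (l * y)) ^ a := by
        rw [Real.mul_rpow hC.le (Real.exp_pos _).le, Real.mul_rpow hC.le (Real.exp_pos _).le,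
          ← Real.exp_mul, ← Real.exp_mul]
        have : C ^ (1 - a) * C ^ a = C := by rw [← Real.rpow_add hC]; simp
        calc C * Real.exp (l * z) = (C ^ (1 - a) * C ^ a) *
              (Real.exp (l * x * (1 - a)) * Real.exp (l * y * a)) := by
              rw [this, ← Real.exp_add, hz]; congr 2; ring
          _ = _ := by ring
      rw [e3]
      have n1 : 0 ≤ slv Φ K (m + x) := ENNReal.toReal_nonneg
      gcongr

end slices

theorem image_width {d : ℕ} {u : EuclideanSpace ℝ (Fin d)} {K : Set (EuclideanSpace ℝ (Fin d))}
    {a : ℝ} (ha : 0 < a) (h : (fun x => ⟪x, u⟫) '' K = Set.Icc (-a) a) : dirWidth u K = 2 * a := by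
  rw [dirWidth, h, csSup_Icc (by linarith), csInf_Icc (by linarith)]; ring

section equality

variable {n : ℕ} {u : EuclideanSpace ℝ (Fin (n + 1))}
  {Φ : EuclideanSpace ℝ (Fin (n + 1)) ≃L[ℝ] ℝ × (Fin n → ℝ)}

theorem cone_eq (mp : MeasurePreserving Φ) (h1 : ∀ x, (Φ x).1 = ⟪x, u⟫) (hΦu : Φ u = (1, 0))
    (hu : ‖u‖ = 1) {a : ℝ} (ha : 0 < a) {B : Set (EuclideanSpace ℝ (Fin (n + 1)))}
    (hB : IsCompact B) (hBu : ∀ x ∈ B, ⟪x, u⟫ = 0) (hi : (interior (doubleCone u a B)).Nonempty) :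
      momentOfInertia u (doubleCone u a B) / (volume (doubleCone u a B)).toReal
        = dirWidth u (doubleCone u a B) ^ 2 / (2 * (n + 2) * (n + 3)) := by
  have huu : ⟪u, u⟫ = (1:ℝ) := by rw [real_inner_self_eq_norm_sq, hu]; simp
  have hin : ∀ b ∈ B, ∀ t c : ℝ, ⟪c • b + t • u, u⟫ = t := by
    intro b hb t c
    rw [inner_add_left, real_inner_smul_left, real_inner_smul_left, hBu b hb, huu]; ring
  obtain ⟨_, b0, hb0, -⟩ := hi.mono interior_subset
  have him : (fun x => ⟪x, u⟫) '' (doubleCone u a B) = Set.Icc (-a) a := by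
    ext t
    constructor
    · rintro ⟨_, ⟨b, hb, t, ht, rfl⟩, rfl⟩
      simp only [hin b hb]
      exact abs_le.mp ht
    · intro ht
      exact ⟨_, ⟨b0, hb0, t, abs_le.mpr ht, rfl⟩, hin b0 hb0 _ _⟩
  have hcK : IsCompact (doubleCone u a B) := by
    have : doubleCone u a B = (fun z : EuclideanSpace ℝ (Fin (n + 1)) × ℝ =>
        (1 - |z.2| / a) • z.1 + z.2 • u) '' (B ×ˢ Set.Icc (-a) a) := by
      ext z
      constructor
      · rintro ⟨b, hb, t, ht, rfl⟩
        exact ⟨(b, t), ⟨hb, abs_le.mp ht⟩, rfl⟩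
      · rintro ⟨⟨b, t⟩, ⟨hb, ht⟩, rfl⟩
        exact ⟨b, hb, t, abs_le.mpr ht, rfl⟩
    rw [this]
    exact (hB.prod isCompact_Icc).image (by fun_prop)
  rw [image_width ha him]
  have hm : ∀ x ∈ doubleCone u a B, -a ≤ ⟪x, u⟫ ∧ ⟪x, u⟫ ≤ -a + 2 * a := by
    intro x hx
    have : ⟪x, u⟫ ∈ Set.Icc (-a) a := him ▸ ⟨x, hx, rfl⟩
    exact ⟨this.1, by linarith [this.2]⟩
  obtain ⟨If, hVpos, hV, hI⟩ := red_moment mp h1 hcK hi (by linarith : 0 ≤ 2 * a) hm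
  set β := slv Φ B 0 with hβ
  have hsl : ∀ t ∈ Set.uIcc 0 (2 * a), slv Φ (doubleCone u a B) (-a + t) =
      β * coneProf n (2 * a) a t := by
    intro t ht
    rw [Set.uIcc_of_le (by linarith)] at ht
    have habs : |(-a + t)| ≤ a := abs_le.mpr ⟨by linarith [ht.1], by linarith [ht.2]⟩
    set c := 1 - |(-a + t)| / a with hc
    have hc0 : 0 ≤ c := by
      rw [hc, sub_nonneg, div_le_one ha]; exact habs
    have hset : Prod.mk (-a + t) ⁻¹' (Φ '' (doubleCone u a B)) =
        c • (Prod.mk (0:ℝ) ⁻¹' (Φ '' B)) := by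
      have hΦ : ∀ b ∈ B, ∀ c' t' : ℝ, Φ (c' • b + t' • u) = (t', c' • (Φ b).2) := by
        intro b hb c' t'
        rw [map_add, map_smul, map_smul, hΦu]
        ext
        · simp [h1, hBu b hb]
        · simp
      ext y
      constructor
      · rintro ⟨_, ⟨b, hb, t', ht', rfl⟩, hxy⟩
        rw [hΦ b hb, Prod.mk.injEq] at hxy
        obtain ⟨rfl, rfl⟩ := hxy
        refine ⟨(Φ b).2, ⟨b, hb, ?_⟩, rfl⟩
        ext <;> simp [h1, hBu b hb]
      · rintro ⟨w, ⟨b, hb, hbw⟩, rfl⟩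
        refine ⟨_, ⟨b, hb, -a + t, habs, rfl⟩, ?_⟩
        rw [hΦ b hb, hbw]
    have hcp : coneProf n (2 * a) a t = c ^ n := by
      rw [coneProf, hc]
      split_ifs with h
      · rw [abs_of_nonpos (by linarith)]; congr 1; field_simp; ring
      · rw [abs_of_nonneg (by linarith)]
        have : 2 * a - a = a := by ring
        rw [this]; congr 1; field_simp; ring
    rw [hcp, slv, hset, Measure.addHaar_smul, ENNReal.toReal_mul, hβ, slv,
      ENNReal.toReal_ofReal (abs_nonneg _), Module.finrank_fin_fun, abs_of_nonneg (pow_nonneg hc0 n)]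
    ring
  have ha2 : a ≤ 2 * a := by linarith
  have E0 : ∫ t in (0:ℝ)..(2 * a), slv Φ (doubleCone u a B) (-a + t) = β * (2 * a / (n + 1)) := by
    rw [intervalIntegral.integral_congr hsl, intervalIntegral.integral_const_mul,
      coneProf_int0 n ha.le ha2]
  have E1 : ∫ t in (0:ℝ)..(2 * a), t * slv Φ (doubleCone u a B) (-a + t) =
      β * (2 * a / (n + 1) * ((2 * a + n * a) / (n + 2))) := by
    rw [← coneProf_int1 n ha.le ha2, ← intervalIntegral.integral_const_mul]
    apply intervalIntegral.integral_congr
    intro t ht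
    simp only [hsl t ht]; ring
  have E2 : ∫ t in (0:ℝ)..(2 * a), t ^ 2 * slv Φ (doubleCone u a B) (-a + t) =
      β * (a ^ 3 / (n + 3) + ((2 * a) ^ 2 * (2 * a - a) / (n + 1) - 2 * (2 * a) * (2 * a - a) ^ 2 / (n + 2)
        + (2 * a - a) ^ 3 / (n + 3))) := by
    rw [← coneProf_int2 n ha.le ha2, ← intervalIntegral.integral_const_mul]
    apply intervalIntegral.integral_congr
    intro t ht
    simp only [hsl t ht]; ring
  have hβ0 : β ≠ 0 := by
    intro h
    rw [E0, h] at hVpos; simp at hVpos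
  rw [hI, hV, E0, E1, E2]
  have n1 : (n : ℝ) + 1 ≠ 0 := by positivity
  have n2 : (n : ℝ) + 2 ≠ 0 := by positivity
  have n3 : (n : ℝ) + 3 ≠ 0 := by positivity
  field_simp
  ring

theorem cyl_eq (mp : MeasurePreserving Φ) (h1 : ∀ x, (Φ x).1 = ⟪x, u⟫) (hΦu : Φ u = (1, 0))
    (hu : ‖u‖ = 1) {a : ℝ} (ha : 0 < a) {B : Set (EuclideanSpace ℝ (Fin (n + 1)))}
    (hB : IsCompact B) (hBu : ∀ x ∈ B, ⟪x, u⟫ = 0) (hi : (interior (cylinder u a B)).Nonempty) :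
      momentOfInertia u (cylinder u a B) / (volume (cylinder u a B)).toReal
        = dirWidth u (cylinder u a B) ^ 2 / 12 := by
  have huu : ⟪u, u⟫ = (1:ℝ) := by rw [real_inner_self_eq_norm_sq, hu]; simp
  have hin : ∀ b ∈ B, ∀ t : ℝ, ⟪b + t • u, u⟫ = t := by
    intro b hb t
    rw [inner_add_left, real_inner_smul_left, hBu b hb, huu]; ring
  obtain ⟨_, b0, hb0, -⟩ := hi.mono interior_subset
  have him : (fun x => ⟪x, u⟫) '' (cylinder u a B) = Set.Icc (-a) a := by
    ext t
    constructor
    · rintro ⟨_, ⟨b, hb, t, ht, rfl⟩, rfl⟩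
      simp only [hin b hb]
      exact abs_le.mp ht
    · intro ht
      exact ⟨_, ⟨b0, hb0, t, abs_le.mpr ht, rfl⟩, hin b0 hb0 _⟩
  have hcK : IsCompact (cylinder u a B) := by
    have : cylinder u a B = (fun z : EuclideanSpace ℝ (Fin (n + 1)) × ℝ =>
        z.1 + z.2 • u) '' (B ×ˢ Set.Icc (-a) a) := by
      ext z
      constructor
      · rintro ⟨b, hb, t, ht, rfl⟩
        exact ⟨(b, t), ⟨hb, abs_le.mp ht⟩, rfl⟩
      · rintro ⟨⟨b, t⟩, ⟨hb, ht⟩, rfl⟩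
        exact ⟨b, hb, t, abs_le.mpr ht, rfl⟩
    rw [this]
    exact (hB.prod isCompact_Icc).image (by fun_prop)
  rw [image_width ha him]
  have hm : ∀ x ∈ cylinder u a B, -a ≤ ⟪x, u⟫ ∧ ⟪x, u⟫ ≤ -a + 2 * a := by
    intro x hx
    have : ⟪x, u⟫ ∈ Set.Icc (-a) a := him ▸ ⟨x, hx, rfl⟩
    exact ⟨this.1, by linarith [this.2]⟩
  obtain ⟨If, hVpos, hV, hI⟩ := red_moment mp h1 hcK hi (by linarith : 0 ≤ 2 * a) hm
  set β := slv Φ B 0 with hβ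
  have hsl : ∀ t ∈ Set.uIcc 0 (2 * a), slv Φ (cylinder u a B) (-a + t) = β := by
    intro t ht
    rw [Set.uIcc_of_le (by linarith)] at ht
    have habs : |(-a + t)| ≤ a := abs_le.mpr ⟨by linarith [ht.1], by linarith [ht.2]⟩
    have hset : Prod.mk (-a + t) ⁻¹' (Φ '' (cylinder u a B)) =
        Prod.mk (0:ℝ) ⁻¹' (Φ '' B) := by
      have hΦ : ∀ b ∈ B, ∀ t' : ℝ, Φ (b + t' • u) = (t', (Φ b).2) := by
        intro b hb t'
        rw [map_add, map_smul, hΦu]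
        ext
        · simp [h1, hBu b hb]
        · simp
      ext y
      constructor
      · rintro ⟨_, ⟨b, hb, t', ht', rfl⟩, hxy⟩
        rw [hΦ b hb, Prod.mk.injEq] at hxy
        obtain ⟨rfl, rfl⟩ := hxy
        refine ⟨b, hb, ?_⟩
        ext <;> simp [h1, hBu b hb]
      · rintro ⟨b, hb, hbw⟩
        refine ⟨_, ⟨b, hb, -a + t, habs, rfl⟩, ?_⟩
        rw [hΦ b hb, hbw]
    rw [slv, hset, hβ, slv]
  have E0 : ∫ t in (0:ℝ)..(2 * a), slv Φ (cylinder u a B) (-a + t) = β * (2 * a) := by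
    rw [intervalIntegral.integral_congr hsl]; simp [mul_comm]
  have E1 : ∫ t in (0:ℝ)..(2 * a), t * slv Φ (cylinder u a B) (-a + t) = β * ((2 * a) ^ 2 / 2) := by
    have : ∫ t in (0:ℝ)..(2 * a), t * slv Φ (cylinder u a B) (-a + t) =
        ∫ t in (0:ℝ)..(2 * a), t * β := by
      apply intervalIntegral.integral_congr
      intro t ht
      simp only [hsl t ht]
    rw [this, intervalIntegral.integral_mul_const, integral_id]; ring
  have E2 : ∫ t in (0:ℝ)..(2 * a), t ^ 2 * slv Φ (cylinder u a B) (-a + t) =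
      β * ((2 * a) ^ 3 / 3) := by
    have : ∫ t in (0:ℝ)..(2 * a), t ^ 2 * slv Φ (cylinder u a B) (-a + t) =
        ∫ t in (0:ℝ)..(2 * a), t ^ 2 * β := by
      apply intervalIntegral.integral_congr
      intro t ht
      simp only [hsl t ht]
    rw [this, intervalIntegral.integral_mul_const, integral_pow]; push_cast; ring
  have hβ0 : β ≠ 0 := by
    intro h
    rw [E0, h] at hVpos; simp at hVpos
  rw [hI, hV, E0, E1, E2]
  field_simp
  ring

end equality

/-- for any convex body `K ⊆ ℝ^d` and unit vector `u`,
`W_u(K)²/(2(d+1)(d+2)) ≤ I_u(K)/vol(K) ≤ W_u(K)²/12`; the lower bound is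
attained by symmetric double cones over `(d-1)`-dimensional convex bodies, and
the upper bound by cylinders over `(d-1)`-dimensional convex bodies. -/
theorem moment_of_inertia_width_bounds (d : ℕ) (hd : 1 ≤ d)
    (u : EuclideanSpace ℝ (Fin d)) (hu : ‖u‖ = 1) :
    (∀ K : Set (EuclideanSpace ℝ (Fin d)), Convex ℝ K → IsCompact K →
      (interior K).Nonempty →
      dirWidth u K ^ 2 / (2 * (d + 1) * (d + 2))
          ≤ momentOfInertia u K / (volume K).toReal ∧
      momentOfInertia u K / (volume K).toReal ≤ dirWidth u K ^ 2 / 12) ∧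
    (∀ a : ℝ, 0 < a → ∀ B : Set (EuclideanSpace ℝ (Fin d)),
      Convex ℝ B → IsCompact B → (∀ x ∈ B, ⟪x, u⟫ = 0) →
      (interior (doubleCone u a B)).Nonempty →
      momentOfInertia u (doubleCone u a B) / (volume (doubleCone u a B)).toReal
        = dirWidth u (doubleCone u a B) ^ 2 / (2 * (d + 1) * (d + 2))) ∧
    (∀ a : ℝ, 0 < a → ∀ B : Set (EuclideanSpace ℝ (Fin d)),
      Convex ℝ B → IsCompact B → (∀ x ∈ B, ⟪x, u⟫ = 0) →
      (interior (cylinder u a B)).Nonempty →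
      momentOfInertia u (cylinder u a B) / (volume (cylinder u a B)).toReal
        = dirWidth u (cylinder u a B) ^ 2 / 12) := by
  obtain ⟨n, rfl⟩ : ∃ n, d = n + 1 := ⟨d - 1, by omega⟩
  obtain ⟨Φ, mp, h1, hΦu⟩ := exists_Phi n u hu
  have e : (2 * (((n + 1 : ℕ) : ℝ) + 1) * (((n + 1 : ℕ) : ℝ) + 2)) = 2 * ((n : ℝ) + 2) * (n + 3) := by
    push_cast; ring
  rw [e]
  refine ⟨fun K hcv hK hi => body_bounds mp h1 hcv hK hi, ?_, ?_⟩
  · intro a ha B _ hB hBu hi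
    exact cone_eq mp h1 hΦu hu ha hB hBu hi
  · intro a ha B _ hB hBu hi
    exact cyl_eq mp h1 hΦu hu ha hB hBu hi

end
end
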